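/- arXiv:1703.08980 — 2 statements merged into one kernel-verified Lean document; each statement's English description precedes it below -/
import Mathlib

section
/- Fix r ≥ 2 and ℓ ≥ 2. Let m, m_1, …, m_ℓ ∈ ℕ be such that q := ⌊(m_i − 1)/r⌋ (floor taken in ℤ) does not depend on i, and set a := (ℓ−1)r. Then the multi-arrangement (A, μ) in ℂ^ℓ with defining polynomial Q(A,μ) = x_1^{m_1} ⋯ x_ℓ^{m_ℓ} · ∏_{1≤i<j≤ℓ} (x_i^r − x_j^r)^{2m} is free with exponents exp(A,μ) = { ma + m_1, …, ma + m_ℓ }. -/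
open MvPolynomial

noncomputable section

abbrev PolyS (ℓ : ℕ) := MvPolynomial (Fin ℓ) ℂ

/-- Membership in `D(A, μ)` for the multi-arrangement in `ℂ^ℓ` consisting of the
coordinate hyperplanes `ker x_i` with multiplicity `mult0 i` and the hyperplanes
`ker (x_i - ζ x_j)` (for `i < j` and `ζ` an `r`-th root of unity) with
multiplicity `multH`.  (A multiplicity `0` means the hyperplane is absent.) -/
def InDeriv {ℓ : ℕ} (r : ℕ) (mult0 : Fin ℓ → ℕ) (multH : ℕ)
    (θ : Derivation ℂ (PolyS ℓ) (PolyS ℓ)) : Prop :=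
  (∀ i, θ (X i) ∈ Ideal.span {(X i : PolyS ℓ) ^ mult0 i}) ∧
  ∀ i j : Fin ℓ, i < j → ∀ ζ : ℂ, ζ ^ r = 1 →
    θ (X i - C ζ * X j) ∈ Ideal.span {(X i - C ζ * X j : PolyS ℓ) ^ multH}

/-- `θ` is homogeneous of polynomial degree `p`. -/
def IsHomogDeriv {ℓ : ℕ} (θ : Derivation ℂ (PolyS ℓ) (PolyS ℓ)) (p : ℕ) : Prop :=
  ∀ i, (θ (X i)).IsHomogeneous p

/-- The multi-arrangement with derivation-module membership predicate `P` is free with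
exponents `e 0, …, e (ℓ-1)`: there is a basis of the module of derivations consisting
of `ℓ` homogeneous derivations of polynomial degrees `e 0, …, e (ℓ-1)`. -/
def IsFreeWithExponents {ℓ : ℕ} (P : Derivation ℂ (PolyS ℓ) (PolyS ℓ) → Prop)
    (e : Fin ℓ → ℕ) : Prop :=
  ∃ θ : Fin ℓ → Derivation ℂ (PolyS ℓ) (PolyS ℓ),
    (∀ i, P (θ i)) ∧
    LinearIndependent (PolyS ℓ) θ ∧
    (∀ η, P η → η ∈ Submodule.span (PolyS ℓ) (Set.range θ)) ∧
    (∀ i, IsHomogDeriv (θ i) (e i))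

/-- Variant of `IsFreeWithExponents` with the exponents given as integers. -/
def IsFreeWithExponentsZ {ℓ : ℕ} (P : Derivation ℂ (PolyS ℓ) (PolyS ℓ) → Prop)
    (e : Fin ℓ → ℤ) : Prop :=
  ∃ θ : Fin ℓ → Derivation ℂ (PolyS ℓ) (PolyS ℓ),
    (∀ i, P (θ i)) ∧
    LinearIndependent (PolyS ℓ) θ ∧
    (∀ η, P η → η ∈ Submodule.span (PolyS ℓ) (Set.range θ)) ∧
    (∀ i, ∃ p : ℕ, (p : ℤ) = e i ∧ IsHomogDeriv (θ i) p)

/-- The linear form `x_i - ζ x_j`. -/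
def diffForm {ℓ : ℕ} (i j : Fin ℓ) (ζ : ℂ) : PolyS ℓ := X i - C ζ * X j

lemma diffForm_irreducible {ℓ : ℕ} {i j : Fin ℓ} (hij : i ≠ j) (ζ : ℂ) :
    Irreducible (diffForm i j ζ) := by
  have h := irreducible_mul_X_add (1 : PolyS ℓ) (-(C ζ * X j)) i one_ne_zero (by simp)
    (by
      intro hi
      rw [vars_neg] at hi
      have := vars_mul _ _ hi
      simp [hij] at this)
    isRelPrime_one_left
  have e : diffForm i j ζ = 1 * X i + -(C ζ * X j) := by rw [diffForm]; ring
  rwa [e]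

lemma diffForm_prime {ℓ : ℕ} {i j : Fin ℓ} (hij : i ≠ j) (ζ : ℂ) :
    Prime (diffForm i j ζ) :=
  (diffForm_irreducible hij ζ).prime

lemma not_dvd_of_eval {ℓ : ℕ} {p q : PolyS ℓ} (v : Fin ℓ → ℂ) (hp : eval v p = 0)
    (hq : eval v q ≠ 0) : ¬ p ∣ q := by
  rintro ⟨g, rfl⟩
  simp [hp] at hq

lemma diffForm_not_dvd_X_left {ℓ : ℕ} {i j : Fin ℓ} (hij : i ≠ j) {ζ : ℂ} (hζ : ζ ≠ 0) :
    ¬ diffForm i j ζ ∣ X i :=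
  not_dvd_of_eval (fun a => if a = i then ζ else 1) (by simp [diffForm, hij.symm]) (by simpa)

lemma isRelPrime_X {ℓ : ℕ} {i j : Fin ℓ} (hij : i ≠ j) :
    IsRelPrime (X i : PolyS ℓ) (X j) := by
  rw [X_prime.irreducible.isRelPrime_iff_not_dvd]
  exact not_dvd_of_eval (fun a => if a = i then 0 else 1) (by simp) (by simp [hij.symm])

lemma isRelPrime_X_diffForm {ℓ : ℕ} (k : Fin ℓ) {i j : Fin ℓ} (hij : i ≠ j) {ζ : ℂ}
    (hζ : ζ ≠ 0) : IsRelPrime (X k : PolyS ℓ) (diffForm i j ζ) := by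
  rw [X_prime.irreducible.isRelPrime_iff_not_dvd]
  by_cases h : k = i
  · exact not_dvd_of_eval (fun a => if a = j then 1 else 0) (by simp [h, hij])
      (by simp [diffForm, hij, hζ])
  · exact not_dvd_of_eval (fun a => if a = i then 1 else 0) (by simp [h])
      (by simp [diffForm, hij.symm])

lemma isRelPrime_diffForm {ℓ : ℕ} {i j k l : Fin ℓ} (hij : i < j) (hkl : k < l) {ζ ξ : ℂ}
    (hζ : ζ ≠ 0) (hξ : ξ ≠ 0) (h : ¬ (i = k ∧ j = l ∧ ζ = ξ)) :
    IsRelPrime (diffForm i j ζ) (diffForm k l ξ) := by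
  rw [(diffForm_irreducible hij.ne ζ).isRelPrime_iff_not_dvd]
  by_cases hl : l = i ∨ l = j
  · refine not_dvd_of_eval (fun a => if a = i then ζ else if a = j then 1 else 0)
      (by simp [diffForm, hij.ne']) ?_
    rcases hl with rfl | rfl
    · simp [diffForm, hkl.ne, (hkl.trans hij).ne, hζ, hξ]
    · by_cases hk : k = i
      · subst hk
        simp only [diffForm, map_sub, map_mul, eval_X, eval_C, if_true, hkl.ne', if_false, mul_one]
        exact sub_ne_zero.2 fun e => h ⟨rfl, rfl, e⟩
      · simp [diffForm, hkl.ne, hij.ne', hk, hξ]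
  · push Not at hl
    refine not_dvd_of_eval
      (fun a => if a = i then ζ else if a = j then 1 else if a = k then 1 else 0)
      (by simp [diffForm, hij.ne']) ?_
    simp only [diffForm, map_sub, map_mul, eval_X, eval_C, hl.1, hl.2, hkl.ne', if_false, if_true,
      mul_zero, sub_zero]
    split_ifs <;> simp [hζ]

/-- The index set of the hyperplanes `ker (x_i - ζ x_j)`, where `i < j` and `ζ ^ r = 1`. -/
def diffIndex (ℓ r : ℕ) : Finset ((Fin ℓ × Fin ℓ) × ℂ) :=
  (Finset.univ.filter fun p : Fin ℓ × Fin ℓ => p.1 < p.2) ×ˢ Polynomial.nthRootsFinset r (1 : ℂ)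

lemma mem_diffIndex {ℓ r : ℕ} (hr : 0 < r) {t : (Fin ℓ × Fin ℓ) × ℂ} :
    t ∈ diffIndex ℓ r ↔ t.1.1 < t.1.2 ∧ t.2 ^ r = 1 := by
  simp [diffIndex, Polynomial.mem_nthRootsFinset hr]

lemma card_filter_lt (ℓ : ℕ) :
    2 * (Finset.univ.filter fun p : Fin ℓ × Fin ℓ => p.1 < p.2).card = ℓ * (ℓ - 1) := by
  have h1 : (Finset.univ.filter fun p : Fin ℓ × Fin ℓ => p.2 < p.1).card =
      (Finset.univ.filter fun p : Fin ℓ × Fin ℓ => p.1 < p.2).card :=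
    Finset.card_equiv (Equiv.prodComm _ _) (by simp)
  have h2 : (Finset.univ.filter fun p : Fin ℓ × Fin ℓ => p.1 < p.2) ∪
      (Finset.univ.filter fun p : Fin ℓ × Fin ℓ => p.2 < p.1) = Finset.univ.offDiag := by
    ext p
    simp [lt_or_lt_iff_ne]
  have h3 := congrArg Finset.card h2
  rw [Finset.card_union_of_disjoint, h1, Finset.offDiag_card] at h3
  · simp only [Finset.card_univ, Fintype.card_fin] at h3
    rw [two_mul, h3, Nat.mul_sub_one]
  · rw [Finset.disjoint_filter]
    exact fun p _ h => h.not_gt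

lemma card_diffIndex (ℓ : ℕ) {r : ℕ} (hr : 0 < r) :
    2 * (diffIndex ℓ r).card = ℓ * ((ℓ - 1) * r) := by
  rw [diffIndex, Finset.card_product,
    (Complex.isPrimitiveRoot_exp r hr.ne').card_nthRootsFinset, ← mul_assoc, card_filter_lt,
    mul_assoc]

/-- The defining polynomial of the multi-arrangement. -/
def definingPoly {ℓ : ℕ} (r : ℕ) (mi : Fin ℓ → ℕ) (M : ℕ) : PolyS ℓ :=
  (∏ i, X i ^ mi i) * ∏ t ∈ diffIndex ℓ r, diffForm t.1.1 t.1.2 t.2 ^ M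

lemma diffForm_isHomogeneous {ℓ : ℕ} (i j : Fin ℓ) (ζ : ℂ) : (diffForm i j ζ).IsHomogeneous 1 :=
  (isHomogeneous_X _ _).sub (isHomogeneous_C_mul_X _ _)

lemma definingPoly_isHomogeneous {ℓ r : ℕ} (hr : 0 < r) (mi : Fin ℓ → ℕ) (m : ℕ) :
    (definingPoly r mi (2 * m)).IsHomogeneous (∑ i, (m * ((ℓ - 1) * r) + mi i)) := by
  have h1 : (∏ i, X i ^ mi i : PolyS ℓ).IsHomogeneous (∑ i, mi i) :=
    IsHomogeneous.prod _ _ _ fun i _ => isHomogeneous_X_pow _ _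
  have h2 := IsHomogeneous.prod (diffIndex ℓ r) (fun t => diffForm t.1.1 t.1.2 t.2 ^ (2 * m))
    (fun _ => 1 * (2 * m)) fun t _ => (diffForm_isHomogeneous _ _ _).pow _
  have h3 := h1.mul h2
  refine (congrArg _ ?_).mpr h3
  rw [Finset.sum_add_distrib, add_comm]
  congr 1
  have := card_diffIndex ℓ hr
  simp only [Finset.sum_const, smul_eq_mul, Finset.card_univ, Fintype.card_fin]
  calc ℓ * (m * ((ℓ - 1) * r)) = m * (ℓ * ((ℓ - 1) * r)) := by ring
    _ = _ := by rw [← this]; ring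

lemma diffForm_ne_zero {ℓ : ℕ} {i j : Fin ℓ} (hij : i ≠ j) (ζ : ℂ) : diffForm i j ζ ≠ 0 :=
  (diffForm_irreducible hij ζ).ne_zero

lemma definingPoly_ne_zero {ℓ r : ℕ} (hr : 0 < r) (mi : Fin ℓ → ℕ) (M : ℕ) :
    definingPoly r mi M ≠ 0 := by
  refine mul_ne_zero (Finset.prod_ne_zero_iff.2 fun i _ => pow_ne_zero _ (X_ne_zero i))
    (Finset.prod_ne_zero_iff.2 fun t ht => pow_ne_zero _ (diffForm_ne_zero ?_ _))
  exact ((mem_diffIndex hr).1 ht).1.ne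

lemma ne_zero_of_pow_eq_one {r : ℕ} (hr : 0 < r) {ζ : ℂ} (h : ζ ^ r = 1) : ζ ≠ 0 := by
  rintro rfl
  simp [hr.ne'] at h

lemma definingPoly_dvd {ℓ r : ℕ} (hr : 0 < r) (mi : Fin ℓ → ℕ) (M : ℕ) {z : PolyS ℓ}
    (hX : ∀ i, X i ^ mi i ∣ z)
    (hD : ∀ i j : Fin ℓ, i < j → ∀ ζ : ℂ, ζ ^ r = 1 → diffForm i j ζ ^ M ∣ z) :
    definingPoly r mi M ∣ z := by
  refine IsRelPrime.mul_dvd ?_ (Finset.prod_dvd_of_isRelPrime ?_ fun i _ => hX i)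
    (Finset.prod_dvd_of_isRelPrime ?_ fun t ht => ?_)
  · refine IsRelPrime.prod_left fun i _ => IsRelPrime.prod_right fun t ht => ?_
    obtain ⟨h1, h2⟩ := (mem_diffIndex hr).1 ht
    exact (isRelPrime_X_diffForm i h1.ne (ne_zero_of_pow_eq_one hr h2)).pow
  · exact fun i _ j _ hij => (isRelPrime_X hij).pow
  · intro s hs t ht hst
    obtain ⟨h1, h2⟩ := (mem_diffIndex hr).1 hs
    obtain ⟨h3, h4⟩ := (mem_diffIndex hr).1 ht
    refine (isRelPrime_diffForm h1 h3 (ne_zero_of_pow_eq_one hr h2)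
      (ne_zero_of_pow_eq_one hr h4) fun h => hst ?_).pow
    exact Prod.ext (Prod.ext h.1 h.2.1) h.2.2
  · obtain ⟨h1, h2⟩ := (mem_diffIndex hr).1 ht
    exact hD _ _ h1 _ h2

lemma inDeriv_iff {ℓ : ℕ} {r : ℕ} {mi : Fin ℓ → ℕ} {M : ℕ}
    {θ : Derivation ℂ (PolyS ℓ) (PolyS ℓ)} :
    InDeriv r mi M θ ↔ (∀ i, X i ^ mi i ∣ θ (X i)) ∧
      ∀ i j : Fin ℓ, i < j → ∀ ζ : ℂ, ζ ^ r = 1 →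
        diffForm i j ζ ^ M ∣ θ (X i) - C ζ * θ (X j) := by
  have h : ∀ (i j : Fin ℓ) (ζ : ℂ), θ (X i - C ζ * X j) = θ (X i) - C ζ * θ (X j) := by
    intro i j ζ
    rw [map_sub, ← smul_eq_C_mul, θ.map_smul, smul_eq_C_mul]
  simp only [InDeriv, Ideal.mem_span_singleton, h, diffForm]

lemma dvd_det_of_dvd_col {ℓ : ℕ} {R : Type*} [CommRing R] (A : Matrix (Fin ℓ) (Fin ℓ) R)
    (j : Fin ℓ) {p : R} (h : ∀ k, p ∣ A k j) : p ∣ A.det := by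
  choose g hg using h
  have : A = A.updateCol j (p • g) := by
    ext a b
    by_cases hb : b = j
    · subst hb; simp [hg]
    · simp [hb]
  rw [this, Matrix.det_updateCol_smul]
  exact dvd_mul_right _ _

/-- The matrix of values of derivations on the coordinates. -/
def coeffMatrix {ℓ : ℕ} (θ : Fin ℓ → Derivation ℂ (PolyS ℓ) (PolyS ℓ)) :
    Matrix (Fin ℓ) (Fin ℓ) (PolyS ℓ) :=
  Matrix.of fun k i => θ k (X i)

lemma definingPoly_dvd_det {ℓ r : ℕ} (hr : 0 < r) {mi : Fin ℓ → ℕ} {M : ℕ}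
    {θ : Fin ℓ → Derivation ℂ (PolyS ℓ) (PolyS ℓ)} (h : ∀ k, InDeriv r mi M (θ k)) :
    definingPoly r mi M ∣ (coeffMatrix θ).det := by
  simp only [inDeriv_iff] at h
  refine definingPoly_dvd hr mi M (fun i => dvd_det_of_dvd_col _ i fun k => (h k).1 i) ?_
  intro i j hij ζ hζ
  rw [← Matrix.det_updateCol_add_smul_self (coeffMatrix θ) hij.ne (-C ζ)]
  refine dvd_det_of_dvd_col _ i fun k => ?_
  simpa [coeffMatrix, sub_eq_add_neg] using (h k).2 i j hij ζ hζ

lemma det_isHomogeneous {ℓ : ℕ} {A : Matrix (Fin ℓ) (Fin ℓ) (PolyS ℓ)} {e : Fin ℓ → ℕ}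
    (h : ∀ k i, (A k i).IsHomogeneous (e k)) : A.det.IsHomogeneous (∑ k, e k) := by
  rw [← Matrix.det_transpose, Matrix.det_apply]
  refine IsHomogeneous.sum _ _ _ fun σ _ => ?_
  have := IsHomogeneous.prod Finset.univ (fun k => A k (σ k)) e fun k _ => h k (σ k)
  rcases Int.units_eq_one_or (Equiv.Perm.sign σ) with hs | hs
  · simpa [hs] using this
  · simpa [hs] using this.neg

lemma sum_smul_derivation_apply {ℓ : ℕ} (a : Fin ℓ → PolyS ℓ)
    (θ : Fin ℓ → Derivation ℂ (PolyS ℓ) (PolyS ℓ)) (f : PolyS ℓ) :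
    (∑ k, a k • θ k) f = ∑ k, a k * θ k f := by
  rw [← Derivation.coeFnAddMonoidHom_apply, map_sum, Finset.sum_apply]
  rfl

/-- Saito's criterion for freeness. -/
theorem isFreeWithExponents_of_det_ne_zero {ℓ r : ℕ} (hr : 0 < r) {mi : Fin ℓ → ℕ} {m : ℕ}
    (θ : Fin ℓ → Derivation ℂ (PolyS ℓ) (PolyS ℓ)) (h : ∀ k, InDeriv r mi (2 * m) (θ k))
    (hhom : ∀ k, IsHomogDeriv (θ k) (m * ((ℓ - 1) * r) + mi k))
    (hdet : (coeffMatrix θ).det ≠ 0) :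
    IsFreeWithExponents (InDeriv r mi (2 * m)) (fun i => m * ((ℓ - 1) * r) + mi i) := by
  refine ⟨θ, h, ?_, ?_, hhom⟩
  · rw [Fintype.linearIndependent_iff]
    intro a ha
    by_contra! hne
    refine hdet (Matrix.exists_vecMul_eq_zero_iff.1 ⟨a, ?_, ?_⟩)
    · rintro rfl
      simp at hne
    · funext i
      have := congrArg (fun D : Derivation ℂ (PolyS ℓ) (PolyS ℓ) => D (X i)) ha
      simpa [Matrix.vecMul, dotProduct, coeffMatrix, sum_smul_derivation_apply] using this
  · intro η hη
    obtain ⟨u, hu⟩ := definingPoly_dvd_det hr h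
    have hQ := definingPoly_ne_zero hr mi (2 * m)
    have hu0 : u ≠ 0 := by
      rintro rfl
      simp [hu] at hdet
    have hdeg := (det_isHomogeneous (A := coeffMatrix θ) fun k i => hhom k i).totalDegree hdet
    rw [hu, totalDegree_mul_of_isDomain hQ hu0,
      (definingPoly_isHomogeneous hr mi m).totalDegree hQ] at hdeg
    obtain ⟨c, rfl⟩ : ∃ c, u = C c := ⟨_, totalDegree_eq_zero_iff_eq_C.1 (by omega)⟩
    have hc : c ≠ 0 := fun hc => hu0 (by simp [hc])
    have hb : ∀ k, definingPoly r mi (2 * m) ∣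
        (coeffMatrix (Function.update θ k η)).det := fun k =>
      definingPoly_dvd_det hr fun l => by
        by_cases hl : l = k
        · subst hl; simpa
        · simpa [hl] using h l
    choose g hg using hb
    have hcram := Matrix.mulVec_cramer (coeffMatrix θ).transpose fun i => η (X i)
    have key : ∀ i, ∑ k, g k * θ k (X i) = C c * η (X i) := by
      intro i
      have h1 := congrFun hcram i
      simp only [Matrix.mulVec, dotProduct, Matrix.transpose_apply, Matrix.det_transpose,
        Pi.smul_apply, smul_eq_mul] at h1
      have h2 : ∀ k, Matrix.cramer (coeffMatrix θ).transpose (fun i => η (X i)) k =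
          definingPoly r mi (2 * m) * g k := by
        intro k
        rw [Matrix.cramer_transpose_apply, ← hg]
        congr 1
        ext a b
        by_cases ha : a = k
        · subst ha; simp [coeffMatrix]
        · simp [coeffMatrix, ha]
      refine mul_left_cancel₀ hQ ?_
      rw [← mul_assoc, ← hu, ← h1, Finset.mul_sum]
      refine Finset.sum_congr rfl fun k _ => ?_
      rw [h2, coeffMatrix, Matrix.of_apply]
      ring
    have hη : η = ∑ k, (C c⁻¹ * g k) • θ k := by
      refine MvPolynomial.derivation_ext fun i => ?_
      have : (∑ k, (C c⁻¹ * g k) • θ k) (X i) = C c⁻¹ * ∑ k, g k * θ k (X i) := by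
        simp [sum_smul_derivation_apply, Finset.mul_sum, mul_assoc]
      rw [this, key, ← mul_assoc, ← C_mul, inv_mul_cancel₀ hc, C_1, one_mul]
    rw [hη]
    exact Submodule.sum_mem _ fun k _ =>
      Submodule.smul_mem _ _ (Submodule.subset_span ⟨k, rfl⟩)

/-- Multiply the `d`-th coefficient of a polynomial by `w d`. -/
def scaleCoeff {R : Type*} [CommRing R] (w : ℕ → R) : Polynomial R →ₗ[R] Polynomial R :=
  Polynomial.lsum fun d => (Polynomial.monomial d).comp (LinearMap.lsmul R R (w d))

lemma scaleCoeff_coeff {R : Type*} [CommRing R] (w : ℕ → R) (p : Polynomial R) (d : ℕ) :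
    (scaleCoeff w p).coeff d = w d * p.coeff d := by
  simp only [scaleCoeff, Polynomial.lsum_apply, Polynomial.sum_def, Polynomial.finsetSum_coeff,
    LinearMap.comp_apply, LinearMap.lsmul_apply, Polynomial.coeff_monomial, smul_eq_mul]
  rw [Finset.sum_ite_eq']
  split_ifs with h
  · rfl
  · rw [Polynomial.notMem_support_iff.1 h, mul_zero]

lemma scaleCoeff_natDegree_le {R : Type*} [CommRing R] (w : ℕ → R) (p : Polynomial R) :
    (scaleCoeff w p).natDegree ≤ p.natDegree := by
  rw [Polynomial.natDegree_le_iff_coeff_eq_zero]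
  intro d hd
  rw [scaleCoeff_coeff, Polynomial.coeff_eq_zero_of_natDegree_lt hd, mul_zero]

lemma dvd_eval_scaleCoeff {R : Type*} [CommRing R] (w : ℕ → R) {p : Polynomial R} {y z : R}
    (h : Polynomial.C z ∣ p.comp (Polynomial.C y * Polynomial.X)) :
    z ∣ (scaleCoeff w p).eval y := by
  rw [Polynomial.C_dvd_iff_dvd_coeff] at h
  rw [Polynomial.eval_eq_sum_range]
  refine Finset.dvd_sum fun d _ => ?_
  have := h d
  rw [Polynomial.comp_C_mul_X_coeff] at this
  rw [scaleCoeff_coeff, mul_assoc]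
  exact this.mul_left _

/-- The operator `r T d/dT + c` on polynomials in `T`. -/
def eulerOp {R : Type*} [CommRing R] (r c : R) : Polynomial R →ₗ[R] Polynomial R :=
  r • (LinearMap.mulLeft R Polynomial.X).comp Polynomial.derivative + c • LinearMap.id

lemma eulerOp_apply {R : Type*} [CommRing R] (r c : R) (p : Polynomial R) :
    eulerOp r c p = Polynomial.C r * (Polynomial.X * Polynomial.derivative p) +
      Polynomial.C c * p := by
  simp [eulerOp, Polynomial.smul_eq_C_mul]

lemma eulerOp_coeff {R : Type*} [CommRing R] (r c : R) (p : Polynomial R) (d : ℕ) :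
    (eulerOp r c p).coeff d = (r * d + c) * p.coeff d := by
  rw [eulerOp_apply, Polynomial.coeff_add, Polynomial.coeff_C_mul, Polynomial.coeff_C_mul]
  cases d with
  | zero => simp
  | succ d =>
    rw [Polynomial.coeff_X_mul, Polynomial.coeff_derivative]
    push_cast
    ring

lemma eulerOp_scaleCoeff {R : Type*} [CommRing R] {r c : R} {w : ℕ → R}
    (hw : ∀ d : ℕ, (r * d + c) * w d = 1) (p : Polynomial R) :
    eulerOp r c (scaleCoeff w p) = p := by
  ext d
  rw [eulerOp_coeff, scaleCoeff_coeff, ← mul_assoc, hw, one_mul]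

lemma X_pow_mul_expand_ode {R : Type*} [CommRing R] {r : ℕ} (hr : 0 < r) (a : ℕ) (n : R)
    (N : Polynomial R) :
    Polynomial.X * Polynomial.derivative (Polynomial.X ^ a * Polynomial.expand R r N) -
      Polynomial.C n * (Polynomial.X ^ a * Polynomial.expand R r N) =
    Polynomial.X ^ a * Polynomial.expand R r (eulerOp (r : R) (a - n) N) := by
  obtain ⟨r, rfl⟩ : ∃ s, r = s + 1 := ⟨r - 1, by omega⟩
  rw [eulerOp_apply, Polynomial.derivative_mul, Polynomial.derivative_expand,
    Polynomial.derivative_X_pow]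
  have ha : Polynomial.X * (Polynomial.C (a : R) * Polynomial.X ^ (a - 1)) =
      Polynomial.C (a : R) * Polynomial.X ^ a := by
    cases a with
    | zero => simp
    | succ a => rw [Nat.add_sub_cancel, pow_succ]; ring
  simp only [map_add, map_mul, Polynomial.expand_C, Polynomial.expand_X, map_sub,
    Nat.add_sub_cancel, map_natCast] at ha ⊢
  linear_combination ha * Polynomial.expand R (r + 1) N

/-- If `t F' - n F` vanishes to order `a` at `A` and to order `b` at `B`, then `t ^ (-n) F` takes
the same value at `A` and `B` up to order `a + b + 1` in `B - A`. -/
lemma pow_dvd_of_ode {R : Type*} [CommRing R] [IsDomain R] [Algebra ℂ R] {A B : R} {n a b : ℕ}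
    {F W : Polynomial R} (hs : Prime (B - A)) (hA : ¬ (B - A) ∣ A)
    (h : Polynomial.X * Polynomial.derivative F - Polynomial.C (n : R) * F =
      (Polynomial.X - Polynomial.C A) ^ a * (Polynomial.X - Polynomial.C B) ^ b * W) :
    (B - A) ^ (a + b + 1) ∣ A ^ n * F.eval B - F.eval A * B ^ n := by
  set s := B - A with hsdef
  set L : Polynomial R := Polynomial.C A + Polynomial.C s * Polynomial.X with hL
  set E := L ^ n
  set Θ := Polynomial.C (A ^ n) * F.comp L - Polynomial.C (F.eval A) * E with hΘ
  have hL' : Polynomial.derivative L = Polynomial.C s := by simp [hL]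
  have hE : L * Polynomial.derivative E = Polynomial.C (n : R) * Polynomial.C s * E := by
    simp only [E, Polynomial.derivative_pow, hL']
    cases n with
    | zero => simp
    | succ n => rw [Nat.add_sub_cancel, pow_succ]; ring
  have hF : L * Polynomial.derivative (F.comp L) - Polynomial.C (n : R) * Polynomial.C s * F.comp L
      = Polynomial.C (s ^ (a + b + 1)) *
        (Polynomial.X ^ a * (Polynomial.X - 1) ^ b * W.comp L) := by
    have h1 := congrArg (fun p => Polynomial.comp p L) h
    simp only [Polynomial.sub_comp, Polynomial.mul_comp, Polynomial.X_comp, Polynomial.C_comp,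
      Polynomial.pow_comp] at h1
    have h2 : L - Polynomial.C A = Polynomial.C s * Polynomial.X := by rw [hL]; ring
    have h3 : L - Polynomial.C B = Polynomial.C s * (Polynomial.X - 1) := by
      rw [hL, hsdef, map_sub]; ring
    rw [h2, h3, mul_pow, mul_pow] at h1
    rw [Polynomial.derivative_comp, hL']
    simp only [map_pow]
    linear_combination Polynomial.C s * h1
  have hode : L * Polynomial.derivative Θ - Polynomial.C (n : R) * Polynomial.C s * Θ =
      Polynomial.C (s ^ (a + b + 1)) * (Polynomial.C (A ^ n) *
        (Polynomial.X ^ a * (Polynomial.X - 1) ^ b * W.comp L)) := by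
    rw [hΘ, Polynomial.derivative_sub, Polynomial.derivative_C_mul, Polynomial.derivative_C_mul]
    linear_combination Polynomial.C (A ^ n) * hF - Polynomial.C (F.eval A) * hE
  have hcoeff : ∀ d, s ^ (a + b + 1) ∣ Θ.coeff d := by
    intro d
    induction d with
    | zero =>
      have : Θ.coeff 0 = 0 := by
        rw [Polynomial.coeff_zero_eq_eval_zero]
        simp [hΘ, E, hL, Polynomial.eval_comp]
        ring
      rw [this]
      exact dvd_zero _
    | succ d ih =>
      have h1 := congrArg (fun p => Polynomial.coeff p d) hode
      have h2 : (L * Polynomial.derivative Θ).coeff d =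
          A * (Θ.coeff (d + 1) * (d + 1)) + s * (d * Θ.coeff d) := by
        rw [hL, add_mul, Polynomial.coeff_add, Polynomial.coeff_C_mul, mul_assoc,
          Polynomial.coeff_C_mul, Polynomial.coeff_derivative]
        cases d with
        | zero => simp
        | succ d =>
          rw [Polynomial.coeff_X_mul, Polynomial.coeff_derivative]
          push_cast
          ring
      simp only [Polynomial.coeff_sub, h2, ← Polynomial.C_mul] at h1
      rw [Polynomial.coeff_C_mul, Polynomial.coeff_C_mul] at h1
      have h3 : s ^ (a + b + 1) ∣ A * (Θ.coeff (d + 1) * (d + 1)) := by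
        have h4 := dvd_add (Dvd.intro _ h1.symm) (ih.mul_left ((n : R) * s - s * d))
        convert h4 using 1
        ring
      have h5 := hs.pow_dvd_of_dvd_mul_left _ hA h3
      have hu : IsUnit ((d : R) + 1) := by
        have := (isUnit_iff_ne_zero.2 (Nat.cast_add_one_ne_zero (R := ℂ) d)).map (algebraMap ℂ R)
        simpa using this
      exact (hu.dvd_mul_right).1 h5
  have hdvd : Polynomial.C (s ^ (a + b + 1)) ∣ Θ := (Polynomial.C_dvd_iff_dvd_coeff _ _).2 hcoeff
  have hev := (Polynomial.evalRingHom (1 : R)).map_dvd hdvd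
  have hB : A + (B - A) = B := by ring
  simpa [hΘ, E, hL, Polynomial.eval_comp, hsdef, hB] using hev

lemma pow_dvd_of_expand_eulerOp {R : Type*} [CommRing R] [IsDomain R] [Algebra ℂ R] {A B : R}
    {r c n a b : ℕ} {N W : Polynomial R} (hr : 0 < r) (hs : Prime (B - A)) (hA : ¬ (B - A) ∣ A)
    (h : Polynomial.expand R r (eulerOp (r : R) ((c : R) - (n : R)) N) =
      (Polynomial.X - Polynomial.C A) ^ a * (Polynomial.X - Polynomial.C B) ^ b * W) :
    (B - A) ^ (a + b + 1) ∣
      A ^ n * (B ^ c * N.eval (B ^ r)) - A ^ c * N.eval (A ^ r) * B ^ n := by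
  have hode := X_pow_mul_expand_ode hr c (n : R) N
  rw [h, mul_left_comm (Polynomial.X ^ c) (_ * _) W] at hode
  simpa only [Polynomial.eval_mul, Polynomial.eval_pow, Polynomial.eval_X,
    Polynomial.expand_eval] using pow_dvd_of_ode hs hA hode

lemma eq_zero_of_eulerOp {R : Type*} [CommRing R] [IsDomain R] [UniqueFactorizationMonoid R]
    [CharZero R] {ι : Type*} [Fintype ι]
    {y : ι → R} (hy : Function.Injective y) (hy0 : ∀ i, y i ≠ 0) {r c : R} (hr : r ≠ 0)
    {m : ℕ} {N G : Polynomial R}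
    (hN : eulerOp r c N = (∏ i, (Polynomial.X - Polynomial.C (y i)) ^ m) * G)
    (hroot : ∀ i, N.eval (y i) = 0) (hdeg : N.natDegree < (m + 1) * Fintype.card ι) : N = 0 := by
  have hpow : ∀ i, (Polynomial.X - Polynomial.C (y i)) ^ (m + 1) ∣ N := by
    intro i
    have hE : (Polynomial.X - Polynomial.C (y i)) ^ m ∣ eulerOp r c N :=
      hN ▸ (Finset.dvd_prod_of_mem (fun i => (Polynomial.X - Polynomial.C (y i)) ^ m)
        (Finset.mem_univ i)).mul_right _
    have : ∀ j ≤ m, (Polynomial.X - Polynomial.C (y i)) ^ (j + 1) ∣ N := by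
      intro j
      induction j with
      | zero =>
        intro _
        rw [zero_add, pow_one, Polynomial.dvd_iff_isRoot]
        exact hroot i
      | succ j ih =>
        intro hj
        obtain ⟨H, hH⟩ := ih (by omega)
        have h1 : (Polynomial.X - Polynomial.C (y i)) ^ j * (Polynomial.X - Polynomial.C (y i)) ∣
            eulerOp r c N := (pow_succ (Polynomial.X - Polynomial.C (y i)) j) ▸ (pow_dvd_pow _ hj).trans hE
        have h2 : eulerOp r c N = (Polynomial.X - Polynomial.C (y i)) ^ j *
            (Polynomial.C r * Polynomial.X * (Polynomial.C ((j : R) + 1) * H) +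
              (Polynomial.X - Polynomial.C (y i)) * (Polynomial.C r * Polynomial.X *
                Polynomial.derivative H + Polynomial.C c * H)) := by
          rw [eulerOp_apply, hH, Polynomial.derivative_mul, Polynomial.derivative_X_sub_C_pow]
          simp only [Nat.add_sub_cancel, map_add, map_natCast, map_one, pow_succ]
          push_cast
          ring
        have hne : (Polynomial.X - Polynomial.C (y i)) ^ j ≠ 0 :=
          pow_ne_zero _ (Polynomial.X_sub_C_ne_zero _)
        rw [h2, mul_dvd_mul_iff_left hne, dvd_add_left (dvd_mul_right _ _),
          Polynomial.dvd_iff_isRoot, Polynomial.IsRoot] at h1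
        simp only [Polynomial.eval_mul, Polynomial.eval_C, Polynomial.eval_X, mul_eq_zero, hr,
          hy0, Nat.cast_add_one_ne_zero, false_or] at h1
        obtain ⟨K, hK⟩ := Polynomial.dvd_iff_isRoot.2 h1
        exact ⟨K, by rw [hH, hK, pow_succ _ (j + 1)]; ring⟩
    exact this m le_rfl
  have hprod : (∏ i, (Polynomial.X - Polynomial.C (y i)) ^ (m + 1)) ∣ N := by
    refine Fintype.prod_dvd_of_isRelPrime (fun i j hij => ?_) hpow
    refine IsRelPrime.pow ((Polynomial.irreducible_X_sub_C _).isRelPrime_iff_not_dvd.2 ?_)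
    rw [Polynomial.dvd_iff_isRoot]
    simp [sub_eq_zero, hy.eq_iff, hij]
  refine Polynomial.eq_zero_of_dvd_of_natDegree_lt hprod (hdeg.trans_le (le_of_eq ?_))
  rw [Polynomial.natDegree_prod_of_monic _ _ fun i _ => (Polynomial.monic_X_sub_C _).pow _]
  simp [mul_comm]

/-- All coefficients of `p` are homogeneous of degree `D`. -/
def CoeffHomogeneous {ℓ : ℕ} (p : Polynomial (PolyS ℓ)) (D : ℕ) : Prop :=
  ∀ d, (p.coeff d).IsHomogeneous D

lemma CoeffHomogeneous.mul {ℓ : ℕ} {p q : Polynomial (PolyS ℓ)} {D D' : ℕ}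
    (hp : CoeffHomogeneous p D) (hq : CoeffHomogeneous q D') : CoeffHomogeneous (p * q) (D + D') := by
  intro d
  rw [Polynomial.coeff_mul]
  exact IsHomogeneous.sum _ _ _ fun x _ => (hp _).mul (hq _)

lemma coeffHomogeneous_one {ℓ : ℕ} : CoeffHomogeneous (1 : Polynomial (PolyS ℓ)) 0 := by
  intro d
  rw [Polynomial.coeff_one]
  split_ifs
  · exact isHomogeneous_one _ _
  · exact isHomogeneous_zero _ _ _

lemma CoeffHomogeneous.pow {ℓ : ℕ} {p : Polynomial (PolyS ℓ)} {D : ℕ}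
    (hp : CoeffHomogeneous p D) (n : ℕ) : CoeffHomogeneous (p ^ n) (n * D) := by
  induction n with
  | zero => simpa using coeffHomogeneous_one
  | succ n ih => rw [pow_succ, add_one_mul]; exact ih.mul hp

lemma CoeffHomogeneous.prod {ℓ : ℕ} {ι : Type*} (s : Finset ι) {p : ι → Polynomial (PolyS ℓ)}
    {D : ι → ℕ} (hp : ∀ i ∈ s, CoeffHomogeneous (p i) (D i)) :
    CoeffHomogeneous (∏ i ∈ s, p i) (∑ i ∈ s, D i) := by
  classical
  induction s using Finset.induction_on with
  | empty => simpa using coeffHomogeneous_one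
  | insert i s hi ih =>
    rw [Finset.prod_insert hi, Finset.sum_insert hi]
    exact (hp i (Finset.mem_insert_self i s)).mul
      (ih fun j hj => hp j (Finset.mem_insert_of_mem hj))

lemma isHomogeneous_eval_scaleCoeff {ℓ : ℕ} (w : ℕ → ℂ) {p : Polynomial (PolyS ℓ)} {y : PolyS ℓ}
    {D : ℕ} (h : CoeffHomogeneous (p.comp (Polynomial.C y * Polynomial.X)) D) :
    ((scaleCoeff (fun d => C (w d)) p).eval y).IsHomogeneous D := by
  rw [Polynomial.eval_eq_sum_range]
  refine IsHomogeneous.sum _ _ _ fun d _ => ?_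
  have := h d
  rw [Polynomial.comp_C_mul_X_coeff] at this
  rw [scaleCoeff_coeff, mul_assoc]
  exact this.C_mul _

lemma isHomogeneous_of_X_pow_mul {ℓ : ℕ} {i : Fin ℓ} {n D : ℕ} {g : PolyS ℓ}
    (h : (X i ^ n * g).IsHomogeneous (n + D)) : g.IsHomogeneous D := by
  intro d hd
  have h1 := @h (Finsupp.single i n + d) (by
    rwa [X_pow_eq_monomial, coeff_monomial_mul, one_mul])
  have h2 : Finsupp.weight (1 : Fin ℓ → ℕ) (Finsupp.single i n) = n := by
    simp [Finsupp.weight_apply]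
  rw [map_add, h2] at h1
  exact Nat.add_left_cancel h1

/-- The exponent of `T - x_j ^ r` in `intPoly`. -/
def intExp {ℓ : ℕ} (m : ℕ) (k j : Fin ℓ) : ℕ := if j = k then m else m + 1

/-- The polynomial `(T - x_k ^ r) ^ m * ∏_{j ≠ k} (T - x_j ^ r) ^ (m + 1)`. -/
def intPoly {ℓ : ℕ} (r m : ℕ) (k : Fin ℓ) : Polynomial (PolyS ℓ) :=
  ∏ j, (Polynomial.X - Polynomial.C (X j ^ r)) ^ intExp m k j

/-- The inverse of `d ↦ r d + c`, where `c = r (Q - (m + 1)) + 1`. -/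
def invWeight (r m Q : ℕ) (d : ℕ) : ℂ :=
  ((r : ℂ) * d + (((r * Q + 1 : ℕ) : ℂ) - ((r * (m + 1) : ℕ) : ℂ)))⁻¹

/-- The preimage of `intPoly` under the operator `r T d/dT + c`. -/
def antiPoly {ℓ : ℕ} (r m Q : ℕ) (k : Fin ℓ) : Polynomial (PolyS ℓ) :=
  scaleCoeff (fun d => C (invWeight r m Q d)) (intPoly r m k)

lemma weight_ne_zero {r : ℕ} (hr : 2 ≤ r) (m Q d : ℕ) :
    (r : ℂ) * d + (((r * Q + 1 : ℕ) : ℂ) - ((r * (m + 1) : ℕ) : ℂ)) ≠ 0 := by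
  intro h
  have h1 : ((r * ((m + 1 : ℤ) - Q - d) : ℤ) : ℂ) = (1 : ℤ) := by
    push_cast at h ⊢
    linear_combination -h
  have h2 : (r : ℤ) ∣ 1 := ⟨_, (Int.cast_injective h1).symm⟩
  have h3 := Int.le_of_dvd one_pos h2
  omega

lemma eulerOp_antiPoly {ℓ r : ℕ} (hr : 2 ≤ r) (m Q : ℕ) (k : Fin ℓ) :
    eulerOp (r : PolyS ℓ) (((r * Q + 1 : ℕ) : PolyS ℓ) - ((r * (m + 1) : ℕ) : PolyS ℓ))
      (antiPoly r m Q k) = intPoly r m k := by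
  refine eulerOp_scaleCoeff (fun d => ?_) _
  have h : (r : PolyS ℓ) * (d : PolyS ℓ) + (((r * Q + 1 : ℕ) : PolyS ℓ) - ((r * (m + 1) : ℕ) : PolyS ℓ)) =
      C ((r : ℂ) * d + (((r * Q + 1 : ℕ) : ℂ) - ((r * (m + 1) : ℕ) : ℂ))) := by
    simp only [map_mul, map_add, map_sub, map_natCast]
  rw [h, ← C_mul, invWeight, mul_inv_cancel₀ (weight_ne_zero hr m Q d), C_1]

lemma sum_intExp {ℓ : ℕ} (m : ℕ) (k : Fin ℓ) : ∑ j, intExp m k j = m + (m + 1) * (ℓ - 1) := by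
  rw [← Finset.add_sum_erase _ _ (Finset.mem_univ k),
    Finset.sum_congr rfl (g := fun _ => m + 1) fun j hj => by
      simp [intExp, Finset.ne_of_mem_erase hj]]
  simp [intExp, mul_comm]

lemma sum_intExp_lt {ℓ : ℕ} (m : ℕ) (k : Fin ℓ) : ∑ j, intExp m k j < (m + 1) * ℓ := by
  obtain ⟨l, rfl⟩ : ∃ l, ℓ = l + 1 := ⟨ℓ - 1, by have := k.pos; omega⟩
  rw [sum_intExp, Nat.add_sub_cancel, mul_add_one (m + 1) l]
  omega

lemma natDegree_intPoly {ℓ : ℕ} (r m : ℕ) (k : Fin ℓ) :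
    (intPoly r m k).natDegree = ∑ j, intExp m k j := by
  rw [intPoly, Polynomial.natDegree_prod_of_monic _ _ fun i _ => (Polynomial.monic_X_sub_C _).pow _]
  simp only [Polynomial.natDegree_pow, Polynomial.natDegree_X_sub_C, mul_one]

lemma intPoly_comp_coeffHomogeneous {ℓ : ℕ} (r m : ℕ) (k i : Fin ℓ) :
    CoeffHomogeneous ((intPoly r m k).comp (Polynomial.C (X i ^ r) * Polynomial.X))
      (∑ j, intExp m k j * r) := by
  rw [intPoly, Polynomial.prod_comp]
  refine CoeffHomogeneous.prod _ fun j _ => ?_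
  rw [Polynomial.pow_comp]
  refine CoeffHomogeneous.pow (fun d => ?_) _
  rw [Polynomial.comp_C_mul_X_coeff, Polynomial.coeff_sub, Polynomial.coeff_X, Polynomial.coeff_C]
  match d with
  | 0 => simpa using (isHomogeneous_X_pow j r).neg
  | 1 => simpa using isHomogeneous_X_pow i r
  | d + 2 => simpa using isHomogeneous_zero _ _ _

lemma antiPoly_eval_isHomogeneous {ℓ : ℕ} (r m Q : ℕ) (k i : Fin ℓ) :
    ((antiPoly r m Q k).eval (X i ^ r)).IsHomogeneous ((m + (m + 1) * (ℓ - 1)) * r) := by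
  rw [← sum_intExp m k, Finset.sum_mul]
  exact isHomogeneous_eval_scaleCoeff _ (intPoly_comp_coeffHomogeneous r m k i)

lemma dvd_antiPoly_eval {ℓ : ℕ} (r m Q : ℕ) (k i : Fin ℓ) :
    (X i ^ r) ^ intExp m k i ∣ (antiPoly r m Q k).eval (X i ^ r) := by
  refine dvd_eval_scaleCoeff _ ?_
  have h : (Polynomial.X - Polynomial.C (X i ^ r)) ^ intExp m k i ∣ intPoly r m k :=
    Finset.dvd_prod_of_mem (fun j => (Polynomial.X - Polynomial.C (X j ^ r)) ^ intExp m k j)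
      (Finset.mem_univ i)
  obtain ⟨W, hW⟩ := h
  refine ⟨(Polynomial.X - 1) ^ intExp m k i *
    W.comp (Polynomial.C (X i ^ r) * Polynomial.X), ?_⟩
  rw [hW, Polynomial.mul_comp, Polynomial.pow_comp, Polynomial.sub_comp, Polynomial.X_comp,
    Polynomial.C_comp, ← mul_assoc,
    (Polynomial.C_pow : Polynomial.C ((X i ^ r : PolyS ℓ) ^ intExp m k i) = _), ← mul_pow]
  congr 2
  ring

/-- The entries of the basis derivations exist as polynomials. -/
lemma exists_entry {ℓ r m Q s : ℕ} (k i : Fin ℓ) {mi : Fin ℓ → ℕ}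
    (hmi : ∀ j, mi j ≤ r * Q) (hs : mi k + r = s + (r * Q + 1)) :
    ∃ g : PolyS ℓ, X i ^ mi i ∣ g ∧ X i ^ (r * (m + 1)) * g =
      X k ^ s * (X i ^ (r * Q + 1) * (antiPoly r m Q k).eval (X i ^ r)) := by
  obtain ⟨G, hG⟩ := dvd_antiPoly_eval r m Q k i
  rw [hG]
  by_cases hik : i = k
  · subst hik
    refine ⟨X i ^ mi i * G, dvd_mul_right _ _, ?_⟩
    have h1 : (X i ^ (r * (m + 1)) * X i ^ mi i : PolyS ℓ) =
        X i ^ s * X i ^ (r * Q + 1) * (X i ^ r) ^ m := by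
      rw [← pow_mul, ← pow_add, ← pow_add, ← pow_add]
      congr 1
      rw [mul_add_one r m]
      omega
    simp only [intExp, if_true]
    linear_combination G * h1
  · refine ⟨X k ^ s * (X i ^ (r * Q + 1) * G), ?_, ?_⟩
    · exact ((pow_dvd_pow _ ((hmi i).trans (Nat.le_succ _))).mul_right _).mul_left _
    · simp only [intExp, hik, if_false, ← pow_mul]
      ring

lemma two_factors_dvd_expand_intPoly {ℓ : ℕ} {r : ℕ} (m : ℕ) (k : Fin ℓ) {i j : Fin ℓ}
    (hij : i ≠ j) {ζ : ℂ} (hζ : ζ ^ r = 1) :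
    (Polynomial.X - Polynomial.C (C ζ * X j)) ^ intExp m k j *
      (Polynomial.X - Polynomial.C (X i)) ^ intExp m k i ∣
        Polynomial.expand (PolyS ℓ) r (intPoly r m k) := by
  have h1 : Polynomial.expand (PolyS ℓ) r (intPoly r m k) =
      ∏ l, (Polynomial.X ^ r - Polynomial.C (X l) ^ r) ^ intExp m k l := by
    simp [intPoly, map_prod]
  rw [h1]
  have hi : (Polynomial.X - Polynomial.C (X i) : Polynomial (PolyS ℓ)) ∣
      Polynomial.X ^ r - Polynomial.C (X i) ^ r := sub_dvd_pow_sub_pow _ _ _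
  have hj : (Polynomial.X - Polynomial.C (C ζ * X j) : Polynomial (PolyS ℓ)) ∣
      Polynomial.X ^ r - Polynomial.C (X j) ^ r := by
    have h2 : (Polynomial.C (X j) ^ r : Polynomial (PolyS ℓ)) = Polynomial.C (C ζ * X j) ^ r := by
      rw [← Polynomial.C_pow, ← Polynomial.C_pow, mul_pow, ← C_pow, hζ, C_1, one_mul]
    rw [h2]
    exact sub_dvd_pow_sub_pow _ _ _
  refine (mul_dvd_mul (pow_dvd_pow_of_dvd hj _) (pow_dvd_pow_of_dvd hi _)).trans ?_
  rw [← Finset.prod_pair (f := fun l =>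
    (Polynomial.X ^ r - Polynomial.C (X l) ^ r) ^ intExp m k l) hij.symm]
  exact Finset.prod_dvd_prod_of_subset _ _ _ (Finset.subset_univ _)

lemma ode_congruence {ℓ r m Q : ℕ} (hr : 2 ≤ r) (k : Fin ℓ) {i j : Fin ℓ} (hij : i ≠ j)
    {ζ : ℂ} (hζ : ζ ^ r = 1) :
    diffForm i j ζ ^ (2 * (m + 1)) ∣ (C ζ * X j) ^ (r * (m + 1)) *
        (X i ^ (r * Q + 1) * (antiPoly r m Q k).eval (X i ^ r)) -
      (C ζ * X j) ^ (r * Q + 1) * (antiPoly r m Q k).eval ((C ζ * X j) ^ r) *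
        X i ^ (r * (m + 1)) := by
  have hr0 : 0 < r := by omega
  have hs : Prime (X i - C ζ * X j) := diffForm_prime hij ζ
  have hX : ¬ (X i - C ζ * X j) ∣ C ζ * X j := fun h =>
    diffForm_not_dvd_X_left hij (ne_zero_of_pow_eq_one hr0 hζ) ((dvd_sub_left h).1 dvd_rfl)
  obtain ⟨W, hW⟩ := two_factors_dvd_expand_intPoly m k hij hζ
  have hdvd := pow_dvd_of_expand_eulerOp (R := PolyS ℓ) (c := r * Q + 1) (n := r * (m + 1))
    hr0 hs hX ((congrArg _ (eulerOp_antiPoly hr m Q k)).trans hW)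
  have hexp : 2 * (m + 1) ≤ intExp m k j + intExp m k i + 1 := by
    unfold intExp
    split_ifs with h1 h2
    · exact absurd (h2.trans h1.symm) hij
    all_goals omega
  exact (pow_dvd_pow _ hexp).trans hdvd

lemma Prime.pow_dvd_sub_of_congruence {R : Type*} [CommRing R] [IsDomain R] {s x y z u v g h c : R}
    {a n : ℕ} (hs : Prime s) (hx : ¬ s ∣ x) (hy : ¬ s ∣ y) (hc : c ^ a = 1)
    (hu : x ^ a * g = z * u) (hv : y ^ a * h = z * v)
    (hd : s ^ n ∣ (c * y) ^ a * u - c * v * x ^ a) : s ^ n ∣ g - c * h := by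
  have hn : ∀ w, ¬ s ∣ w → ¬ s ∣ w ^ a := fun w hw h => hw (hs.dvd_of_dvd_pow h)
  refine hs.pow_dvd_of_dvd_mul_left _ (hn y hy) (hs.pow_dvd_of_dvd_mul_left _ (hn x hx) ?_)
  convert hd.mul_left z using 1
  rw [mul_pow, hc]
  linear_combination y ^ a * hu - c * x ^ a * hv

lemma diffForm_pow_dvd {ℓ r m Q s : ℕ} (hr : 2 ≤ r) (k : Fin ℓ) {i j : Fin ℓ} (hij : i ≠ j)
    {ζ : ℂ} (hζ : ζ ^ r = 1) {gi gj : PolyS ℓ}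
    (hi : X i ^ (r * (m + 1)) * gi =
      X k ^ s * (X i ^ (r * Q + 1) * (antiPoly r m Q k).eval (X i ^ r)))
    (hj : X j ^ (r * (m + 1)) * gj =
      X k ^ s * (X j ^ (r * Q + 1) * (antiPoly r m Q k).eval (X j ^ r))) :
    diffForm i j ζ ^ (2 * (m + 1)) ∣ gi - C ζ * gj := by
  have hζ0 := ne_zero_of_pow_eq_one (by omega) hζ
  have hXi := diffForm_not_dvd_X_left hij hζ0
  have hXj : ¬ diffForm i j ζ ∣ X j := fun h =>
    hXi ((dvd_sub_left (h.mul_left (C ζ))).1 dvd_rfl)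
  have hζC : (C ζ : PolyS ℓ) ^ r = 1 := by rw [← C_pow, hζ, C_1]
  refine (diffForm_prime hij ζ).pow_dvd_sub_of_congruence hXi hXj
    (by rw [pow_mul, hζC, one_pow]) hi hj ?_
  have h := ode_congruence (m := m) (Q := Q) hr k hij hζ
  have h1 : (C ζ * X j : PolyS ℓ) ^ r = X j ^ r := by rw [mul_pow, hζC, one_mul]
  have h2 : (C ζ * X j : PolyS ℓ) ^ (r * Q + 1) = C ζ * X j ^ (r * Q + 1) := by
    rw [mul_pow, pow_succ (C ζ), pow_mul, hζC, one_pow, one_mul]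
  rw [h1, h2, mul_assoc (C ζ)] at h
  exact h

lemma X_pow_injective {ℓ r : ℕ} (hr : 0 < r) :
    Function.Injective fun i : Fin ℓ => (X i ^ r : PolyS ℓ) := by
  intro i j h
  by_contra hij
  have := congrArg (eval fun a : Fin ℓ => if a = i then 1 else 0) h
  simp [hr.ne', eq_comm] at this
  exact hij this

lemma det_ne_zero_of_entries {ℓ r m Q : ℕ} (hr : 2 ≤ r) (s : Fin ℓ → ℕ)
    {A : Matrix (Fin ℓ) (Fin ℓ) (PolyS ℓ)}
    (hA : ∀ k i, X i ^ (r * (m + 1)) * A k i =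
      X k ^ s k * (X i ^ (r * Q + 1) * (antiPoly r m Q k).eval (X i ^ r))) : A.det ≠ 0 := by
  intro hdet
  obtain ⟨a, ha0, ha⟩ := Matrix.exists_vecMul_eq_zero_iff.2 hdet
  have hr0 : 0 < r := by omega
  have hinj := X_pow_injective (ℓ := ℓ) hr0
  set b : Fin ℓ → PolyS ℓ := fun k => a k * X k ^ s k with hb
  set N : Polynomial (PolyS ℓ) := ∑ k, b k • antiPoly r m Q k with hN
  have hE : eulerOp (r : PolyS ℓ) (((r * Q + 1 : ℕ) : PolyS ℓ) - ((r * (m + 1) : ℕ) : PolyS ℓ)) N =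
      (∏ i, (Polynomial.X - Polynomial.C (X i ^ r)) ^ m) *
        ∑ k, b k • ∏ j ∈ Finset.univ.erase k, (Polynomial.X - Polynomial.C (X j ^ r)) := by
    rw [hN, map_sum, Finset.mul_sum]
    refine Finset.sum_congr rfl fun k _ => ?_
    rw [map_smul, eulerOp_antiPoly hr, mul_smul_comm]
    congr 1
    rw [intPoly, ← Finset.mul_prod_erase _ _ (Finset.mem_univ k),
      ← Finset.mul_prod_erase (Finset.univ) (fun i => (Polynomial.X - Polynomial.C (X i ^ r)) ^ m)
        (Finset.mem_univ k), mul_assoc, ← Finset.prod_mul_distrib]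
    congr 1
    · simp [intExp]
    · refine Finset.prod_congr rfl fun j hj => ?_
      simp [intExp, Finset.ne_of_mem_erase hj, pow_succ]
  have hroot : ∀ i, N.eval (X i ^ r) = 0 := by
    intro i
    have h1 := congrFun ha i
    simp only [Matrix.vecMul, dotProduct, Pi.zero_apply] at h1
    have h2 : X i ^ (r * Q + 1) * N.eval (X i ^ r) = 0 := by
      rw [hN, Polynomial.eval_finsetSum, Finset.mul_sum, ← mul_zero (X i ^ (r * (m + 1))), ← h1,
        Finset.mul_sum]
      refine Finset.sum_congr rfl fun k _ => ?_
      rw [Polynomial.eval_smul, smul_eq_mul, hb]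
      linear_combination -a k * hA k i
    exact (mul_eq_zero.1 h2).resolve_left (pow_ne_zero _ (X_ne_zero i))
  have hdeg : N.natDegree < (m + 1) * Fintype.card (Fin ℓ) := by
    obtain ⟨k₀, _⟩ : ∃ k, a k ≠ 0 := Function.ne_iff.1 ha0
    rw [Fintype.card_fin]
    have hpos : 0 < (m + 1) * ℓ := Nat.mul_pos m.succ_pos k₀.pos
    refine lt_of_le_of_lt (Polynomial.natDegree_sum_le_of_forall_le _ _ (n := (m + 1) * ℓ - 1)
      fun k _ => ?_) (Nat.sub_lt hpos one_pos)
    refine (Polynomial.natDegree_smul_le _ _).trans ((scaleCoeff_natDegree_le _ _).trans ?_)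
    rw [natDegree_intPoly]
    exact Nat.le_sub_one_of_lt (sum_intExp_lt m k)
  have hN0 := eq_zero_of_eulerOp hinj (fun i => pow_ne_zero _ (X_ne_zero i))
    (Nat.cast_ne_zero.2 hr0.ne') hE hroot hdeg
  rw [hN0, map_zero, eq_comm, mul_eq_zero] at hE
  have hsum := hE.resolve_left (Finset.prod_ne_zero_iff.2 fun i _ =>
    pow_ne_zero _ (Polynomial.X_sub_C_ne_zero _))
  refine ha0 (funext fun k => ?_)
  have hev := congrArg (Polynomial.eval (X k ^ r)) hsum
  rw [Polynomial.eval_finsetSum, Finset.sum_eq_single k] at hev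
  · rw [Polynomial.eval_smul, Polynomial.eval_zero, Polynomial.eval_prod, smul_eq_mul,
      mul_eq_zero, Finset.prod_eq_zero_iff] at hev
    rcases hev with h | ⟨j, hj, h⟩
    · exact (mul_eq_zero.1 h).resolve_right (pow_ne_zero _ (X_ne_zero k))
    · simp only [Polynomial.eval_sub, Polynomial.eval_X, Polynomial.eval_C, sub_eq_zero] at h
      exact absurd (hinj h).symm (Finset.ne_of_mem_erase hj)
  · intro l _ hl
    rw [Polynomial.eval_smul, Polynomial.eval_prod,
      Finset.prod_eq_zero (Finset.mem_erase.2 ⟨hl.symm, Finset.mem_univ k⟩) (by simp), smul_zero]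
  · simp

lemma exists_common_quotient {r ℓ : ℕ} (hr : 0 < r) (hℓ : 0 < ℓ) {mi : Fin ℓ → ℕ} {q : ℤ}
    (hq : ∀ i, Int.fdiv ((mi i : ℤ) - 1) (r : ℤ) = q) :
    ∃ Q : ℕ, ∀ i, r * Q + 1 ≤ mi i + r ∧ mi i ≤ r * Q := by
  have hr' : (0 : ℤ) < r := by exact_mod_cast hr
  have hdiv : ∀ i, r * q ≤ (mi i : ℤ) - 1 ∧ (mi i : ℤ) - 1 < r * q + r := by
    intro i
    have h1 := hq i
    rw [Int.fdiv_eq_ediv_of_nonneg _ hr'.le] at h1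
    have h2 := Int.mul_ediv_add_emod ((mi i : ℤ) - 1) r
    rw [h1] at h2
    have h3 := Int.emod_nonneg ((mi i : ℤ) - 1) hr'.ne'
    have h4 := Int.emod_lt_of_pos ((mi i : ℤ) - 1) hr'
    omega
  have hq0 : 0 ≤ q + 1 := by
    have := (hdiv ⟨0, hℓ⟩).2
    by_contra! h
    nlinarith
  obtain ⟨Q, hQ⟩ := Int.eq_ofNat_of_zero_le hq0
  refine ⟨Q, fun i => ?_⟩
  have h1 : (r : ℤ) * Q = r * q + r := by rw [← hQ]; ring
  have h2 := hdiv i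
  zify
  omega

theorem stmt5 (r ℓ : ℕ) (hr : 2 ≤ r) (hℓ : 2 ≤ ℓ)
    (m : ℕ) (mi : Fin ℓ → ℕ)
    (q : ℤ) (hq : ∀ i, Int.fdiv ((mi i : ℤ) - 1) (r : ℤ) = q) :
    IsFreeWithExponents (InDeriv r mi (2 * m))
      (fun i => m * ((ℓ - 1) * r) + mi i) := by
  have hr0 : 0 < r := by omega
  obtain _ | m := m
  · refine isFreeWithExponents_of_det_ne_zero hr0
      (fun k => mkDerivation ℂ (Pi.single k (X k ^ mi k))) (fun k => ?_) (fun k i => ?_) ?_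
    · refine inDeriv_iff.2 ⟨fun i => ?_, fun i j _ ζ _ => by simp⟩
      rw [mkDerivation_X]
      by_cases h : i = k
      · subst h; simp
      · simp [h]
    · rw [mkDerivation_X]
      by_cases h : i = k
      · subst h; simpa using isHomogeneous_X_pow i (mi i)
      · simpa [h] using isHomogeneous_zero _ _ _
    · have h : coeffMatrix (fun k => mkDerivation ℂ (Pi.single k (X k ^ mi k))) =
          Matrix.diagonal fun k => (X k ^ mi k : PolyS ℓ) := by
        ext1 k i
        rw [coeffMatrix, Matrix.of_apply, mkDerivation_X, Matrix.diagonal_apply, Pi.single_apply]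
        by_cases h : i = k
        · subst h; simp
        · simp [h, Ne.symm h]
      rw [h, Matrix.det_diagonal]
      exact Finset.prod_ne_zero_iff.2 fun i _ => pow_ne_zero _ (X_ne_zero i)
  · obtain ⟨Q, hQ⟩ := exists_common_quotient hr0 (by omega) hq
    set s : Fin ℓ → ℕ := fun k => mi k + r - (r * Q + 1) with hs
    have hs' : ∀ k, mi k + r = s k + (r * Q + 1) := fun k => (Nat.sub_add_cancel (hQ k).1).symm
    choose g hg hg' using fun k i : Fin ℓ =>
      exists_entry (m := m) k i (fun j => (hQ j).2) (hs' k)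
    refine isFreeWithExponents_of_det_ne_zero hr0 (fun k => mkDerivation ℂ (g k))
      (fun k => inDeriv_iff.2 ⟨fun i => ?_, fun i j hij ζ hζ => ?_⟩) (fun k i => ?_) ?_
    · rw [mkDerivation_X]
      exact hg k i
    · rw [mkDerivation_X, mkDerivation_X]
      exact diffForm_pow_dvd hr k hij.ne hζ (hg' k i) (hg' k j)
    · rw [mkDerivation_X]
      refine isHomogeneous_of_X_pow_mul (i := i) (n := r * (m + 1)) ?_
      rw [hg' k i]
      have h := (isHomogeneous_X_pow (R := ℂ) k (s k)).mul
        ((isHomogeneous_X_pow i (r * Q + 1)).mul (antiPoly_eval_isHomogeneous r m Q k i))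
      refine (congrArg _ ?_).mpr h
      have h1 := hs' k
      have h2 : r * (m + 1) + (m + 1) * ((ℓ - 1) * r) = r + (m + (m + 1) * (ℓ - 1)) * r := by ring
      omega
    · refine det_ne_zero_of_entries hr s (m := m) (Q := Q) fun k i => ?_
      rw [coeffMatrix, Matrix.of_apply, mkDerivation_X]
      exact hg' k i
end
end

section
/- Fix r ≥ 2 and ℓ ≥ 2. Let m, m_1, …, m_ℓ ∈ ℕ be such that q := ⌊(m_i − 1)/r⌋ (floor taken in ℤ) does not depend on i, and set a := (ℓ−1)r, m' := Σ_{i=1}^ℓ m_i, and c := ma + qr + 1. Then the multi-arrangement (A, μ) in ℂ^ℓ with defining polynomial Q(A,μ) = x_1^{m_1} ⋯ x_ℓ^{m_ℓ} · ∏_{1≤i<j≤ℓ} (x_i^r − x_j^r)^{2m+1} is free with exponents exp(A,μ) = { c + m' − ℓ(qr+1), c + r, c + 2r, …, c + (ℓ−1)r }. -/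
open MvPolynomial

noncomputable section

/-- The `R`-linear endomorphism of `R[u]` rescaling `u ^ n` by `c n`. -/
def diagonalMap {R : Type*} [CommRing R] (c : ℕ → R) : Polynomial R →ₗ[R] Polynomial R :=
  Polynomial.lsum fun n => c n • Polynomial.monomial n

section Univariate

variable {R : Type*} [CommRing R] (c : ℕ → R)

lemma diagonalMap_coeff (p : Polynomial R) (n : ℕ) :
    (diagonalMap c p).coeff n = c n * p.coeff n := by
  induction p using Polynomial.induction_on' with
  | add p q hp hq => simp [hp, hq, mul_add]
  | monomial k a =>
    simp only [diagonalMap, Polynomial.lsum_apply, LinearMap.smul_apply]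
    rw [Polynomial.sum_monomial_index _ _ (by simp), Polynomial.coeff_smul,
      Polynomial.coeff_monomial]
    split_ifs with h <;> simp [h]

lemma diagonalMap_mul (a : R) (p : Polynomial R) :
    diagonalMap c (Polynomial.C a * p) = Polynomial.C a * diagonalMap c p := by
  rw [← Polynomial.smul_eq_C_mul, map_smul, Polynomial.smul_eq_C_mul]

lemma natDegree_diagonalMap_le (p : Polynomial R) :
    (diagonalMap c p).natDegree ≤ p.natDegree := by
  rw [Polynomial.natDegree_le_iff_coeff_eq_zero]
  intro n hn
  rw [diagonalMap_coeff, Polynomial.coeff_eq_zero_of_natDegree_lt hn, mul_zero]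

lemma euler_diagonalMap {s e : R} (hc : ∀ n : ℕ, (s + e * n) * c n = 1) (p : Polynomial R) :
    Polynomial.C s * diagonalMap c p
      + Polynomial.C e * (Polynomial.X * Polynomial.derivative (diagonalMap c p)) = p := by
  ext n
  rw [Polynomial.coeff_add, Polynomial.coeff_C_mul, Polynomial.coeff_C_mul]
  have hder : (Polynomial.X * Polynomial.derivative (diagonalMap c p)).coeff n
      = n * (c n * p.coeff n) := by
    cases n with
    | zero => simp
    | succ k =>
      rw [Polynomial.coeff_X_mul, Polynomial.coeff_derivative, diagonalMap_coeff]
      push_cast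
      ring
  rw [hder, diagonalMap_coeff]
  linear_combination p.coeff n * hc n

lemma pow_dvd_eval_diagonalMap (v : R) (a k : ℕ) (h : Polynomial R) :
    v ^ (a + k) ∣ (diagonalMap c
      ((Polynomial.X - Polynomial.C v) ^ a * (Polynomial.X ^ k * h))).eval v := by
  induction a generalizing k with
  | zero =>
    have hX : Polynomial.X ^ k ∣ diagonalMap c (Polynomial.X ^ k * h) := by
      rw [Polynomial.X_pow_dvd_iff]
      intro d hd
      rw [diagonalMap_coeff, Polynomial.X_pow_dvd_iff.1 (dvd_mul_right _ h) d hd, mul_zero]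
    simpa using Polynomial.eval_dvd (x := v) hX
  | succ a ih =>
    have hsplit : (Polynomial.X - Polynomial.C v) ^ (a + 1) * (Polynomial.X ^ k * h)
        = (Polynomial.X - Polynomial.C v) ^ a * (Polynomial.X ^ (k + 1) * h)
          - Polynomial.C v * ((Polynomial.X - Polynomial.C v) ^ a * (Polynomial.X ^ k * h)) := by
      ring
    rw [hsplit, map_sub, diagonalMap_mul, Polynomial.eval_sub, Polynomial.eval_mul,
      Polynomial.eval_C]
    refine dvd_sub ?_ ?_
    · rw [add_right_comm, add_assoc]
      exact ih (k + 1)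
    · rw [add_right_comm, pow_succ']
      exact mul_dvd_mul_left v (ih k)

lemma pow_succ_dvd_of_pow_dvd_euler [IsDomain R] [CharZero R] {s e y : R} (he : e ≠ 0)
    (hy : y ≠ 0) {f : Polynomial R} (hf : f.eval y = 0) (b : ℕ)
    (h : (Polynomial.X - Polynomial.C y) ^ b ∣ Polynomial.C s * f
      + Polynomial.C e * (Polynomial.X * Polynomial.derivative f)) :
    (Polynomial.X - Polynomial.C y) ^ (b + 1) ∣ f := by
  induction b with
  | zero => simpa [Polynomial.dvd_iff_isRoot] using hf
  | succ b ih =>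
    obtain ⟨g, hg⟩ := ih ((pow_dvd_pow _ b.le_succ).trans h)
    obtain ⟨k, hk⟩ := h
    have hne : (Polynomial.X - Polynomial.C y) ^ b ≠ 0 :=
      pow_ne_zero _ (Polynomial.X_sub_C_ne_zero y)
    have hkey : (Polynomial.X - Polynomial.C y) * (Polynomial.C s * g
          + Polynomial.C e * (Polynomial.X * Polynomial.derivative g))
        + Polynomial.C e * (Polynomial.X * (((b : Polynomial R) + 1) * g))
        = (Polynomial.X - Polynomial.C y) * k := by
      refine mul_left_cancel₀ hne ?_
      rw [hg] at hk
      simp only [Polynomial.derivative_mul, Polynomial.derivative_X_sub_C_pow] at hk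
      push_cast at hk
      simp only [map_add, map_natCast, map_one] at hk
      linear_combination hk
    have heval := congrArg (Polynomial.eval y) hkey
    simp only [Polynomial.eval_add, Polynomial.eval_mul, Polynomial.eval_sub, Polynomial.eval_X,
      Polynomial.eval_C, sub_self, zero_mul, zero_add, Polynomial.eval_natCast,
      Polynomial.eval_one] at heval
    have hb : (b : R) + 1 ≠ 0 := Nat.cast_add_one_ne_zero b
    have hroot : g.eval y = 0 := by simpa [he, hy, hb] using heval
    rw [hg, pow_succ _ (b + 1)]
    exact mul_dvd_mul_left _ (Polynomial.dvd_iff_isRoot.2 hroot)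

lemma sub_pow_dvd_diagonalMap_base [IsDomain R] [CharZero R] {A N r : ℕ}
    (hc : ∀ n : ℕ, ((A - N : R) + r * n) * c n = 1) (x : R) {y : R} (hy : y ≠ 0) (b : ℕ)
    (h : Polynomial R) :
    (x - y) ^ (b + 1) ∣
      y ^ N * x ^ A * (diagonalMap c
        ((Polynomial.X - Polynomial.C (y ^ r)) ^ b * h)).eval (x ^ r)
      - x ^ N * y ^ A * (diagonalMap c
        ((Polynomial.X - Polynomial.C (y ^ r)) ^ b * h)).eval (y ^ r) := by
  set p := (Polynomial.X - Polynomial.C (y ^ r)) ^ b * h with hp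
  set g := diagonalMap c p
  set f : Polynomial R := Polynomial.C (y ^ N) * Polynomial.X ^ A * g.comp (Polynomial.X ^ r)
    - Polynomial.X ^ N * Polynomial.C (y ^ A * g.eval (y ^ r)) with hf
  have hXder (n : ℕ) : Polynomial.X * Polynomial.derivative (Polynomial.X ^ n : Polynomial R)
      = (n : Polynomial R) * Polynomial.X ^ n := by
    cases n with
    | zero => simp
    | succ n => simp only [Polynomial.derivative_X_pow, Nat.add_sub_cancel, map_natCast]; ring
  have heuler : Polynomial.C (-(N : R)) * f
      + Polynomial.C 1 * (Polynomial.X * Polynomial.derivative f)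
      = Polynomial.C (y ^ N) * Polynomial.X ^ A * p.comp (Polynomial.X ^ r) := by
    have hg := congrArg (fun z => Polynomial.comp z (Polynomial.X ^ r)) (euler_diagonalMap c hc p)
    simp only [Polynomial.add_comp, Polynomial.mul_comp, Polynomial.C_comp,
      Polynomial.X_comp] at hg
    simp only [hf, Polynomial.derivative_sub, Polynomial.derivative_mul, Polynomial.derivative_C,
      Polynomial.derivative_comp]
    simp only [map_sub, map_natCast, map_neg, map_one] at hg ⊢
    linear_combination (Polynomial.C (y ^ N) * Polynomial.X ^ A) * hg
      + Polynomial.C (y ^ N) * g.comp (Polynomial.X ^ r) * hXder A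
      - Polynomial.C (y ^ A * g.eval (y ^ r)) * hXder N
      + Polynomial.C (y ^ N) * Polynomial.X ^ A *
        (Polynomial.derivative g).comp (Polynomial.X ^ r) * hXder r
  have hdvd : (Polynomial.X - Polynomial.C y) ^ b ∣ p.comp (Polynomial.X ^ r) := by
    rw [hp, Polynomial.mul_comp, Polynomial.pow_comp, Polynomial.sub_comp, Polynomial.X_comp,
      Polynomial.C_comp, map_pow]
    exact (pow_dvd_pow_of_dvd (sub_dvd_pow_sub_pow _ _ _) _).mul_right _
  have hroot : f.eval y = 0 := by simp [hf]; ring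
  have hmain := pow_succ_dvd_of_pow_dvd_euler one_ne_zero hy hroot b
    (heuler ▸ hdvd.mul_left _)
  simpa [hf, mul_assoc] using Polynomial.eval_dvd (x := x) hmain

lemma sub_pow_dvd_diagonalMap [IsDomain R] [CharZero R] {A N r : ℕ}
    (hc : ∀ n : ℕ, ((A - N : R) + r * n) * c n = 1) (x : R) {y : R} (hy : y ≠ 0) (a b : ℕ)
    (h : Polynomial R) :
    (x - y) ^ (a + b + 1) ∣
      y ^ N * x ^ A * (diagonalMap c ((Polynomial.X - Polynomial.C (x ^ r)) ^ a *
        ((Polynomial.X - Polynomial.C (y ^ r)) ^ b * h))).eval (x ^ r)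
      - x ^ N * y ^ A * (diagonalMap c ((Polynomial.X - Polynomial.C (x ^ r)) ^ a *
        ((Polynomial.X - Polynomial.C (y ^ r)) ^ b * h))).eval (y ^ r) := by
  induction a generalizing b with
  | zero => simpa using sub_pow_dvd_diagonalMap_base c hc x hy b h
  | succ a ih =>
    set P := fun a b : ℕ => (Polynomial.X - Polynomial.C (x ^ r)) ^ a *
        ((Polynomial.X - Polynomial.C (y ^ r)) ^ b * h)
    have hsplit : P (a + 1) b = P a (b + 1) + Polynomial.C (y ^ r - x ^ r) * P a b := by
      simp only [P, map_sub]
      ring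
    change _ ∣ y ^ N * x ^ A * (diagonalMap c (P (a + 1) b)).eval (x ^ r)
      - x ^ N * y ^ A * (diagonalMap c (P (a + 1) b)).eval (y ^ r)
    rw [hsplit, map_add, diagonalMap_mul]
    simp only [Polynomial.eval_add, Polynomial.eval_mul, Polynomial.eval_C]
    have h1 := ih (b + 1)
    have hsub : x - y ∣ y ^ r - x ^ r := by
      rw [← neg_sub (x ^ r)]
      exact (sub_dvd_pow_sub_pow x y r).neg_right
    have h2 := mul_dvd_mul hsub (ih b)
    rw [← pow_succ'] at h2
    rw [show a + (b + 1) + 1 = a + 1 + b + 1 by ring] at h1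
    rw [show a + b + 1 + 1 = a + 1 + b + 1 by ring] at h2
    refine (dvd_add h1 h2).trans (dvd_of_eq ?_)
    simp only [P]
    ring

/-- Nonvanishing: a polynomial `p` of degree less than the number of nodes `v i` is zero as soon as
the primitive of `p * ∏ (u - v i) ^ m` vanishes at all the nodes. -/
lemma eq_zero_of_eval_diagonalMap_eq_zero [IsDomain R] [UniqueFactorizationMonoid R] [CharZero R]
    {ι : Type*} [Fintype ι] {s e : R} (he : e ≠ 0)
    (hc : ∀ n : ℕ, (s + e * n) * c n = 1) {v : ι → R} (hv : Function.Injective v)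
    (hv0 : ∀ i, v i ≠ 0) (m : ℕ) {p : Polynomial R} (hp : p.degree < Fintype.card ι)
    (h : ∀ i, (diagonalMap c
      (p * ∏ j, (Polynomial.X - Polynomial.C (v j)) ^ m)).eval (v i) = 0) :
    p = 0 := by
  classical
  by_contra hp0
  set q := p * ∏ j, (Polynomial.X - Polynomial.C (v j)) ^ m with hq
  have hmonic (k : ℕ) : (∏ j, (Polynomial.X - Polynomial.C (v j)) ^ k).Monic :=
    Polynomial.monic_prod_of_monic _ _ fun j _ => (Polynomial.monic_X_sub_C _).pow k
  have hdeg (k : ℕ) : (∏ j, (Polynomial.X - Polynomial.C (v j)) ^ k).natDegree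
      = Fintype.card ι * k := by
    rw [Polynomial.natDegree_prod_of_monic _ _ fun j _ => (Polynomial.monic_X_sub_C _).pow k]
    simp [Polynomial.natDegree_pow]
  have hq0 : q ≠ 0 := mul_ne_zero hp0 (hmonic m).ne_zero
  have hg0 : diagonalMap c q ≠ 0 := by
    intro h0
    have := euler_diagonalMap c hc q
    rw [h0] at this
    simp at this
    exact hq0 this.symm
  have hdvd : ∏ j, (Polynomial.X - Polynomial.C (v j)) ^ (m + 1) ∣ diagonalMap c q := by
    refine Fintype.prod_dvd_of_isRelPrime ?_ fun i => ?_
    · intro i j hij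
      refine IsRelPrime.pow ?_
      rw [(Polynomial.prime_X_sub_C _).irreducible.isRelPrime_iff_not_dvd,
        Polynomial.dvd_iff_isRoot]
      simpa [Polynomial.IsRoot, sub_eq_zero] using fun h => hij (hv h)
    · refine pow_succ_dvd_of_pow_dvd_euler (s := s) he (hv0 i) (h i) m ?_
      rw [euler_diagonalMap c hc]
      exact (Finset.dvd_prod_of_mem _ (Finset.mem_univ i)).mul_left _
  have hle := Polynomial.natDegree_le_of_dvd hdvd hg0
  have hle' := hle.trans (natDegree_diagonalMap_le c q)
  rw [hdeg, hq, Polynomial.natDegree_mul hp0 (hmonic m).ne_zero, hdeg] at hle'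
  rw [← Polynomial.natDegree_lt_iff_degree_lt hp0] at hp
  linarith [mul_add_one (Fintype.card ι) m]

end Univariate

section LinearForms

variable {ℓ : ℕ}

lemma isHomogeneous_X_sub_C_mul_X (i j : Fin ℓ) (ζ : ℂ) :
    (X i - C ζ * X j : PolyS ℓ).IsHomogeneous 1 :=
  (isHomogeneous_X _ _).sub (isHomogeneous_C_mul_X _ _)

lemma prime_X_sub_C_mul_X {i j : Fin ℓ} (hij : i ≠ j) (ζ : ℂ) :
    Prime (X i - C ζ * X j : PolyS ℓ) := by
  have hne : (X i - C ζ * X j : PolyS ℓ) ≠ 0 := by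
    intro h
    have := congrArg (MvPolynomial.eval (Pi.single i (1 : ℂ))) h
    simp [hij.symm] at this
  refine (irreducible_of_totalDegree_eq_one
    ((isHomogeneous_X_sub_C_mul_X i j ζ).totalDegree hne) fun x hx => ?_).prime
  obtain ⟨d, hd⟩ := exists_coeff_ne_zero hne
  refine isUnit_iff_ne_zero.2 ?_
  rintro rfl
  exact hd (zero_dvd_iff.1 (hx d))

lemma not_dvd_of_eval_s6 {f g : PolyS ℓ} (p : Fin ℓ → ℂ) (hf : MvPolynomial.eval p f = 0)
    (hg : MvPolynomial.eval p g ≠ 0) : ¬ f ∣ g := fun h =>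
  hg (zero_dvd_iff.1 (hf ▸ map_dvd (MvPolynomial.eval p) h))

lemma norm_eq_one_of_mem_nthRootsFinset {r : ℕ} {ζ : ℂ}
    (hζ : ζ ∈ Polynomial.nthRootsFinset r (1 : ℂ)) : ‖ζ‖ = 1 := by
  have hr : 0 < r := by
    rcases Nat.eq_zero_or_pos r with rfl | h
    · simp at hζ
    · exact h
  exact Complex.norm_eq_one_of_pow_eq_one ((Polynomial.mem_nthRootsFinset hr _).1 hζ) hr.ne'

/-- The hyperplanes of the arrangement: the coordinate hyperplanes and, for each pair of distinct
coordinates and each `r`-th root of unity, one further hyperplane. -/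
abbrev HyperplaneIndex (r ℓ : ℕ) :=
  Fin ℓ ⊕ ((Σ i : Fin ℓ, Fin i) × {ζ : ℂ // ζ ∈ Polynomial.nthRootsFinset r (1 : ℂ)})

/-- The smaller coordinate of a pair. -/
abbrev smallerIndex (p : Σ i : Fin ℓ, Fin i) : Fin ℓ := Fin.castLE p.1.isLt.le p.2

lemma smallerIndex_lt (p : Σ i : Fin ℓ, Fin i) : smallerIndex p < p.1 := p.2.isLt

/-- The linear form defining a hyperplane. -/
def hyperplaneForm {r : ℕ} : HyperplaneIndex r ℓ → PolyS ℓ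
  | .inl i => X i
  | .inr (p, ζ) => X (smallerIndex p) - C ζ.1 * X p.1

/-- The multiplicity of a hyperplane. -/
def hyperplaneMult {r : ℕ} (mult0 : Fin ℓ → ℕ) (multH : ℕ) : HyperplaneIndex r ℓ → ℕ
  | .inl i => mult0 i
  | .inr _ => multH

lemma prime_hyperplaneForm {r : ℕ} (a : HyperplaneIndex r ℓ) : Prime (hyperplaneForm a) := by
  rcases a with i | ⟨p, ζ⟩
  · exact X_prime
  · exact prime_X_sub_C_mul_X (smallerIndex_lt p).ne _

lemma isHomogeneous_hyperplaneForm {r : ℕ} (a : HyperplaneIndex r ℓ) :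
    (hyperplaneForm a).IsHomogeneous 1 := by
  rcases a with i | ⟨p, ζ⟩
  · exact isHomogeneous_X _ _
  · exact isHomogeneous_X_sub_C_mul_X _ _ _

/-- A linear form `x_i - ζ x_j` with `‖ζ‖ = 1` does not vanish at a point whose coordinates
`i` and `j` have different norms. -/
lemma eval_X_sub_C_mul_X_ne_zero {i j : Fin ℓ} {ζ : ℂ} (hζ : ‖ζ‖ = 1) {p : Fin ℓ → ℂ}
    (hp : ‖p i‖ ≠ ‖p j‖) : MvPolynomial.eval p (X i - C ζ * X j : PolyS ℓ) ≠ 0 := by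
  simp only [map_sub, map_mul, eval_X, eval_C]
  intro h
  rw [sub_eq_zero] at h
  exact hp (by rw [h, norm_mul, hζ, one_mul])

lemma not_hyperplaneForm_dvd {r : ℕ} {a b : HyperplaneIndex r ℓ} (hab : a ≠ b) :
    ¬ hyperplaneForm a ∣ hyperplaneForm b := by
  have hinj (i j : Fin ℓ) : ‖(2 : ℂ) ^ (i : ℕ)‖ = ‖(2 : ℂ) ^ (j : ℕ)‖ ↔ i = j := by
    simp [Fin.ext_iff]
  rcases a with i | ⟨⟨i, i'⟩, ζ, hζ⟩
  · refine not_dvd_of_eval_s6 (fun k => if k = i then 0 else 2 ^ (k : ℕ)) (by simp [hyperplaneForm]) ?_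
    rcases b with k | ⟨p, ξ, hξ⟩
    · have : k ≠ i := fun h => hab (by rw [h])
      simp [hyperplaneForm, this]
    · refine eval_X_sub_C_mul_X_ne_zero (norm_eq_one_of_mem_nthRootsFinset hξ) ?_
      have hlt := (smallerIndex_lt p).ne
      by_cases h1 : smallerIndex p = i
      · have h2 : p.1 ≠ i := fun h => hlt (h1.trans h.symm)
        simp only [h1, if_true, if_neg h2, norm_zero]
        exact (norm_ne_zero_iff.2 (pow_ne_zero _ two_ne_zero)).symm
      · by_cases h2 : p.1 = i
        · simp only [h2, if_true, if_neg h1, norm_zero]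
          simp
        · simpa only [if_neg h1, if_neg h2, ne_eq, hinj] using hlt
  · set j := smallerIndex ⟨i, i'⟩ with hj
    have hji : j ≠ i := (smallerIndex_lt ⟨i, i'⟩).ne
    have hnζ := norm_eq_one_of_mem_nthRootsFinset hζ
    set P : Fin ℓ → ℂ := fun k => if k = j then ζ * 2 ^ (i : ℕ) else 2 ^ (k : ℕ) with hP
    have hPj : P j = ζ * 2 ^ (i : ℕ) := by simp [hP]
    have hPk {k} (hk : k ≠ j) : P k = 2 ^ (k : ℕ) := by simp [hP, hk]
    refine not_dvd_of_eval_s6 P ?_ ?_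
    · change MvPolynomial.eval P (X j - C ζ * X i) = 0
      simp [hPj, hPk hji.symm]
    · have hζ0 : ζ ≠ 0 := by
        rintro rfl
        simp at hnζ
      rcases b with k | ⟨⟨k, k'⟩, ξ, hξ⟩
      · change MvPolynomial.eval P (X k) ≠ 0
        by_cases hk : k = j
        · simp [hk, hPj, hζ0]
        · simp [hPk hk]
      · set l := smallerIndex ⟨k, k'⟩ with hl
        have hlk : l < k := smallerIndex_lt ⟨k, k'⟩
        have hji' : j < i := smallerIndex_lt ⟨i, i'⟩
        change MvPolynomial.eval P (X l - C ξ * X k) ≠ 0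
        have hnξ := norm_eq_one_of_mem_nthRootsFinset hξ
        by_cases hcase : l = j ∧ k = i
        · obtain ⟨h1, rfl⟩ := hcase
          have hk' : i' = k' := by
            apply Fin.ext
            exact (congrArg Fin.val h1).symm
          subst hk'
          have hζξ : ζ ≠ ξ := by
            rintro rfl
            exact hab rfl
          rw [h1]
          simp [hPj, hPk hji.symm, ← sub_mul, sub_eq_zero, hζξ]
        · refine eval_X_sub_C_mul_X_ne_zero hnξ ?_
          by_cases h1 : l = j
          · have h2 : k ≠ i := fun h => hcase ⟨h1, h⟩
            rw [h1, hPj, hPk (h1 ▸ hlk.ne'), norm_mul, hnζ, one_mul, ne_eq, hinj]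
            exact h2.symm
          · by_cases h2 : k = j
            · rw [h2, hPj, hPk h1, norm_mul, hnζ, one_mul, ne_eq, hinj]
              exact ((h2 ▸ hlk).trans hji').ne
            · rw [hPk h1, hPk h2, ne_eq, hinj]
              exact hlk.ne

lemma isRelPrime_hyperplaneForm {r : ℕ} {a b : HyperplaneIndex r ℓ} (hab : a ≠ b) :
    IsRelPrime (hyperplaneForm a) (hyperplaneForm b) :=
  (prime_hyperplaneForm a).irreducible.isRelPrime_iff_not_dvd.2 (not_hyperplaneForm_dvd hab)

lemma MvPolynomial.IsHomogeneous.of_X_pow_mul {i : Fin ℓ} {N d : ℕ} {f : PolyS ℓ}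
    (h : (X i ^ N * f).IsHomogeneous (N + d)) : f.IsHomogeneous d := by
  intro u hu
  have hcoeff : coeff (Finsupp.single i N + u) (X i ^ N * f) ≠ 0 := by
    rwa [X_pow_eq_monomial, coeff_monomial_mul, one_mul]
  have := h hcoeff
  rw [map_add] at this
  simpa [Finsupp.weight_single] using this

lemma dvd_of_dvd_of_isHomogeneous {f g : PolyS ℓ} {n : ℕ} (hf : f.IsHomogeneous n)
    (hg : g.IsHomogeneous n) (hg0 : g ≠ 0) (h : f ∣ g) : g ∣ f := by
  obtain ⟨k, rfl⟩ := h
  have hf0 := left_ne_zero_of_mul hg0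
  have hk0 := right_ne_zero_of_mul hg0
  have hdeg := totalDegree_mul_of_isDomain hf0 hk0
  rw [hg.totalDegree hg0, hf.totalDegree hf0] at hdeg
  have hk := totalDegree_eq_zero_iff_eq_C.1 (show k.totalDegree = 0 by omega)
  have hu : IsUnit k := by
    rw [hk]
    refine (isUnit_iff_ne_zero.2 ?_).map C
    intro h0
    rw [h0, map_zero] at hk
    exact hk0 hk
  exact (hu.mul_right_dvd (a := f) (b := f)).2 dvd_rfl

end LinearForms

section Saito

variable {ℓ : ℕ}

lemma dvd_det_of_dvd_col_s6 {R : Type*} [CommRing R] {n : Type*} [Fintype n] [DecidableEq n]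
    {M : Matrix n n R} {a : R} (j : n) (h : ∀ i, a ∣ M i j) : a ∣ M.det := by
  rw [Matrix.det_apply]
  refine Finset.dvd_sum fun σ _ => ?_
  rw [Units.smul_def, zsmul_eq_mul]
  refine Dvd.dvd.mul_left ((h (σ j)).trans ?_) _
  exact Finset.dvd_prod_of_mem (fun i => M (σ i) i) (Finset.mem_univ j)

lemma isHomogeneous_det {M : Matrix (Fin ℓ) (Fin ℓ) (PolyS ℓ)} {e : Fin ℓ → ℕ}
    (h : ∀ k i, (M k i).IsHomogeneous (e k)) : M.det.IsHomogeneous (∑ k, e k) := by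
  rw [Matrix.det_apply']
  refine IsHomogeneous.sum _ _ _ fun σ _ => ?_
  rw [← map_intCast (C : ℂ →+* PolyS ℓ)]
  refine IsHomogeneous.C_mul ?_ _
  rw [← Equiv.sum_comp σ e]
  exact IsHomogeneous.prod _ _ _ fun i _ => h (σ i) i

/-- The coefficients of a derivation, as a linear map. -/
def derivCoords : Derivation ℂ (PolyS ℓ) (PolyS ℓ) →ₗ[PolyS ℓ] (Fin ℓ → PolyS ℓ) where
  toFun η i := η (X i)
  map_add' _ _ := rfl
  map_smul' _ _ := rfl

/-- The coefficient matrix of a family of derivations. -/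
def derivMatrix (θ : Fin ℓ → Derivation ℂ (PolyS ℓ) (PolyS ℓ)) :
    Matrix (Fin ℓ) (Fin ℓ) (PolyS ℓ) := Matrix.of fun k i => θ k (X i)

lemma hyperplaneForm_pow_dvd_det {r : ℕ} (hr : 0 < r) {mult0 : Fin ℓ → ℕ} {multH : ℕ}
    {θ : Fin ℓ → Derivation ℂ (PolyS ℓ) (PolyS ℓ)} (hθ : ∀ k, InDeriv r mult0 multH (θ k))
    (a : HyperplaneIndex r ℓ) :
    hyperplaneForm a ^ hyperplaneMult mult0 multH a ∣ (derivMatrix θ).det := by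
  rcases a with i | ⟨p, ζ, hζ⟩
  · exact dvd_det_of_dvd_col_s6 i fun k => Ideal.mem_span_singleton.1 ((hθ k).1 i)
  · have hlt := smallerIndex_lt p
    rw [← Matrix.det_updateCol_add_smul_self (derivMatrix θ) hlt.ne (-C ζ)]
    refine dvd_det_of_dvd_col_s6 (smallerIndex p) fun k => ?_
    have := Ideal.mem_span_singleton.1
      ((hθ k).2 _ _ hlt ζ ((Polynomial.mem_nthRootsFinset hr _).1 hζ))
    rw [map_sub, Derivation.leibniz, ← algebraMap_eq, Derivation.map_algebraMap] at this
    simpa [derivMatrix, hyperplaneForm, hyperplaneMult, sub_eq_add_neg] using this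

lemma prod_hyperplaneForm_dvd_det {r : ℕ} (hr : 0 < r) {mult0 : Fin ℓ → ℕ} {multH : ℕ}
    {θ : Fin ℓ → Derivation ℂ (PolyS ℓ) (PolyS ℓ)} (hθ : ∀ k, InDeriv r mult0 multH (θ k)) :
    ∏ a : HyperplaneIndex r ℓ, hyperplaneForm a ^ hyperplaneMult mult0 multH a
      ∣ (derivMatrix θ).det :=
  Fintype.prod_dvd_of_isRelPrime (fun _ _ hab => (isRelPrime_hyperplaneForm hab).pow)
    (hyperplaneForm_pow_dvd_det hr hθ)

lemma sum_hyperplaneMult {r : ℕ} (hr : 0 < r) (mult0 : Fin ℓ → ℕ) (multH : ℕ) :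
    ∑ a : HyperplaneIndex r ℓ, hyperplaneMult mult0 multH a
      = ∑ i, mult0 i + (∑ i : Fin ℓ, (i : ℕ)) * r * multH := by
  rw [Fintype.sum_sum_type]
  congr 1
  have hcard : Fintype.card {ζ : ℂ // ζ ∈ Polynomial.nthRootsFinset r (1 : ℂ)} = r := by
    rw [Fintype.card_coe]
    exact (Complex.isPrimitiveRoot_exp r hr.ne').card_nthRootsFinset
  simp only [hyperplaneMult, Finset.sum_const, Finset.card_univ, Fintype.card_prod, hcard,
    Fintype.card_sigma, Fintype.card_fin, smul_eq_mul]

/-- Saito's criterion. -/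
theorem linearIndependent_and_span_of_det_ne_zero {r : ℕ} (hr : 0 < r) {mult0 : Fin ℓ → ℕ}
    {multH : ℕ} {θ : Fin ℓ → Derivation ℂ (PolyS ℓ) (PolyS ℓ)}
    (hθ : ∀ k, InDeriv r mult0 multH (θ k)) {e : Fin ℓ → ℕ} (he : ∀ k, IsHomogDeriv (θ k) (e k))
    (hsum : ∑ k, e k = ∑ i, mult0 i + (∑ i : Fin ℓ, (i : ℕ)) * r * multH)
    (hdet : (derivMatrix θ).det ≠ 0) :
    LinearIndependent (PolyS ℓ) θ ∧
      ∀ η, InDeriv r mult0 multH η → η ∈ Submodule.span (PolyS ℓ) (Set.range θ) := by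
  constructor
  · exact LinearIndependent.of_comp derivCoords (Matrix.linearIndependent_rows_of_det_ne_zero hdet)
  · intro η hη
    set M := derivMatrix θ with hM
    have hQ : (∏ a : HyperplaneIndex r ℓ, hyperplaneForm a ^ hyperplaneMult mult0 multH a
        : PolyS ℓ).IsHomogeneous (∑ k, e k) := by
      rw [hsum, ← sum_hyperplaneMult hr]
      refine IsHomogeneous.prod _ _ _ fun a _ => ?_
      simpa using (isHomogeneous_hyperplaneForm a).pow (hyperplaneMult mult0 multH a)
    have hdvd := dvd_of_dvd_of_isHomogeneous hQ (isHomogeneous_det fun k i => he k i) hdet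
      (prod_hyperplaneForm_dvd_det hr hθ)
    have hcramer (k : Fin ℓ) : M.det ∣ Matrix.cramer M.transpose (fun i => η (X i)) k := by
      rw [Matrix.cramer_transpose_apply]
      have hrow : M.updateRow k (fun i => η (X i)) = derivMatrix (Function.update θ k η) := by
        ext1 k' i
        by_cases hk : k' = k
        · subst hk
          simp [derivMatrix]
        · simp [hM, derivMatrix, hk]
      rw [hrow]
      refine hdvd.trans (prod_hyperplaneForm_dvd_det hr fun k' => ?_)
      by_cases hk : k' = k
      · subst hk
        simpa using hη
      · simpa [hk] using hθ k'
    choose b hb using hcramer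
    have hη_eq : η = ∑ k, b k • θ k := by
      refine MvPolynomial.derivation_ext fun i => mul_left_cancel₀ hdet ?_
      have := congrFun (Matrix.mulVec_cramer M.transpose fun i => η (X i)) i
      rw [Matrix.det_transpose] at this
      simp only [Pi.smul_apply, smul_eq_mul] at this
      have hcoords : (∑ k, b k • θ k) (X i) = ∑ k, b k * θ k (X i) := by
        change derivCoords (∑ k, b k • θ k) i = _
        rw [map_sum, Finset.sum_apply]
        rfl
      rw [← this, hcoords, Matrix.mulVec, dotProduct, Finset.mul_sum]
      refine Finset.sum_congr rfl fun k _ => ?_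
      rw [hb]
      change θ k (X i) * _ = _
      ring
    rw [hη_eq]
    exact Submodule.sum_mem _ fun k _ => Submodule.smul_mem _ _ (Submodule.subset_span ⟨k, rfl⟩)

end Saito

section Basis

variable {ℓ : ℕ}

/-- All terms `a_n x_i ^ (r n)` of the value of `P = ∑ a_n u ^ n` at `u = x_i ^ r` are homogeneous
of degree `D`. -/
def HasHomogeneousTerms (r : ℕ) (i : Fin ℓ) (P : Polynomial (PolyS ℓ)) (D : ℕ) : Prop :=
  ∀ n, (P.coeff n * (X i ^ r) ^ n).IsHomogeneous D

lemma HasHomogeneousTerms.mul {r : ℕ} {i : Fin ℓ} {P Q : Polynomial (PolyS ℓ)} {D E : ℕ}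
    (hP : HasHomogeneousTerms r i P D) (hQ : HasHomogeneousTerms r i Q E) :
    HasHomogeneousTerms r i (P * Q) (D + E) := by
  intro n
  rw [Polynomial.coeff_mul, Finset.sum_mul]
  refine IsHomogeneous.sum _ _ _ fun ab hab => ?_
  have := (hP ab.1).mul (hQ ab.2)
  rw [← Finset.HasAntidiagonal.mem_antidiagonal.1 hab, pow_add]
  convert! this using 1
  ring

lemma HasHomogeneousTerms.one (r : ℕ) (i : Fin ℓ) : HasHomogeneousTerms r i 1 0 := by
  intro n
  rw [Polynomial.coeff_one]
  split_ifs with h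
  · simp [h, isHomogeneous_one]
  · simp [isHomogeneous_zero]

lemma HasHomogeneousTerms.pow {r : ℕ} {i : Fin ℓ} {P : Polynomial (PolyS ℓ)} {D : ℕ}
    (hP : HasHomogeneousTerms r i P D) (k : ℕ) : HasHomogeneousTerms r i (P ^ k) (k * D) := by
  induction k with
  | zero => simpa using HasHomogeneousTerms.one r i
  | succ k ih =>
    rw [pow_succ, add_one_mul]
    exact ih.mul hP

lemma HasHomogeneousTerms.prod {r : ℕ} {i : Fin ℓ} {ι : Type*} (s : Finset ι)
    {P : ι → Polynomial (PolyS ℓ)} {D : ℕ} (hP : ∀ j ∈ s, HasHomogeneousTerms r i (P j) D) :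
    HasHomogeneousTerms r i (∏ j ∈ s, P j) (s.card * D) := by
  classical
  induction s using Finset.induction_on with
  | empty => simpa using HasHomogeneousTerms.one r i
  | insert a s ha ih =>
    rw [Finset.prod_insert ha, Finset.card_insert_of_notMem ha, add_one_mul, add_comm]
    exact (hP a (Finset.mem_insert_self a s)).mul
      (ih fun j hj => hP j (Finset.mem_insert_of_mem hj))

lemma HasHomogeneousTerms.X (r : ℕ) (i : Fin ℓ) : HasHomogeneousTerms r i Polynomial.X r := by
  intro n
  rw [Polynomial.coeff_X]
  split_ifs with h
  · simpa [← h] using isHomogeneous_X_pow i r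
  · simp [isHomogeneous_zero]

lemma HasHomogeneousTerms.X_sub_C (r : ℕ) (i j : Fin ℓ) :
    HasHomogeneousTerms r i (Polynomial.X - Polynomial.C (MvPolynomial.X j ^ r)) r := by
  intro n
  rw [Polynomial.coeff_sub, sub_mul]
  refine (HasHomogeneousTerms.X r i n).sub ?_
  rw [Polynomial.coeff_C]
  split_ifs with h
  · simpa [h] using isHomogeneous_X_pow j r
  · simp [isHomogeneous_zero]

lemma HasHomogeneousTerms.eval_diagonalMap {r : ℕ} {i : Fin ℓ} {P : Polynomial (PolyS ℓ)}
    {D : ℕ} (hP : HasHomogeneousTerms r i P D) (c : ℕ → ℂ) :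
    ((diagonalMap (fun n => (C (c n) : PolyS ℓ)) P).eval (MvPolynomial.X i ^ r)).IsHomogeneous
      D := by
  rw [Polynomial.eval_eq_sum_range]
  refine IsHomogeneous.sum _ _ _ fun n _ => ?_
  rw [diagonalMap_coeff, mul_assoc]
  exact (hP n).C_mul _

/-- The integrand `u ^ k * ∏ (u - x_j ^ r) ^ m`, with `u = t ^ r`. -/
def integrand (ℓ r m k : ℕ) : Polynomial (PolyS ℓ) :=
  Polynomial.X ^ k * ∏ j : Fin ℓ, (Polynomial.X - Polynomial.C (X j ^ r)) ^ m

lemma integrand_hasHomogeneousTerms (r m k : ℕ) (i : Fin ℓ) :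
    HasHomogeneousTerms r i (integrand ℓ r m k) ((m * ℓ + k) * r) := by
  have := ((HasHomogeneousTerms.X r i).pow k).mul (HasHomogeneousTerms.prod Finset.univ
    fun j _ => (HasHomogeneousTerms.X_sub_C r i j).pow m)
  convert! this using 1
  rw [Finset.card_univ, Fintype.card_fin]
  ring

/-- The coefficients of the formal integration of `t ^ (A - N - 1) * P(t ^ r)`. -/
def primitiveCoeff (A N r n : ℕ) : ℂ := ((A : ℂ) - N + r * n)⁻¹

lemma primitiveCoeff_spec {A N r q m : ℕ} (hr : 2 ≤ r) (hA : A = q * r) (hN : N + 1 = (m + 1) * r)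
    (n : ℕ) :
    ((A : PolyS ℓ) - (N : PolyS ℓ) + (r : PolyS ℓ) * (n : PolyS ℓ)) * C (primitiveCoeff A N r n)
      = 1 := by
  have hne : (A : ℂ) - N + r * n ≠ 0 := by
    intro h
    have hz : (A : ℤ) - N + r * n = 0 := by exact_mod_cast h
    have hdvd : (r : ℤ) ∣ 1 := by
      refine ⟨m + 1 - q - n, ?_⟩
      rw [hA] at hz
      push_cast at hz
      have : (N : ℤ) + 1 = (m + 1) * r := by exact_mod_cast hN
      linear_combination this + hz
    have := Int.le_of_dvd one_pos hdvd
    omega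
  have hcast : (A : PolyS ℓ) - (N : PolyS ℓ) + (r : PolyS ℓ) * (n : PolyS ℓ)
      = C ((A : ℂ) - N + r * n) := by simp
  rw [hcast, ← map_mul, primitiveCoeff, mul_inv_cancel₀ hne, map_one]

/-- The value at `u = x_i ^ r` of the formal primitive of the `k`-th integrand, divided by
a power of `t`. -/
def primitiveValue (A N r m k : ℕ) (i : Fin ℓ) : PolyS ℓ :=
  (diagonalMap (fun n => (C (primitiveCoeff A N r n) : PolyS ℓ))
    (integrand ℓ r m k)).eval (X i ^ r)

lemma isHomogeneous_primitiveValue (A N r m k : ℕ) (i : Fin ℓ) :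
    (primitiveValue A N r m k i).IsHomogeneous ((m * ℓ + k) * r) :=
  (integrand_hasHomogeneousTerms r m k i).eval_diagonalMap _

lemma X_pow_dvd_primitiveValue (A N r m k : ℕ) (i : Fin ℓ) :
    (X i ^ r) ^ (m + k) ∣ primitiveValue A N r m k i := by
  have hsplit : integrand ℓ r m k = (Polynomial.X - Polynomial.C (X i ^ r)) ^ m *
      (Polynomial.X ^ k * ∏ j ∈ Finset.univ.erase i,
        (Polynomial.X - Polynomial.C (X j ^ r)) ^ m) := by
    rw [integrand, ← Finset.mul_prod_erase _ _ (Finset.mem_univ i)]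
    ring
  rw [primitiveValue, hsplit]
  exact pow_dvd_eval_diagonalMap _ _ _ _ _

lemma X_sub_C_mul_X_pow_dvd_primitiveValue {A N r q m : ℕ} (hr : 2 ≤ r) (hA : A = q * r)
    (hN : N + 1 = (m + 1) * r) (k : ℕ) {i j : Fin ℓ} (hij : i ≠ j) {ζ : ℂ} (hζ : ζ ^ r = 1) :
    (X i - C ζ * X j) ^ (2 * m + 1) ∣
      (C ζ * X j) ^ N * (X i ^ A * primitiveValue A N r m k i)
      - X i ^ N * ((C ζ * X j) ^ A * primitiveValue A N r m k j) := by
  have hsplit : integrand ℓ r m k = (Polynomial.X - Polynomial.C (X i ^ r)) ^ m *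
      ((Polynomial.X - Polynomial.C (X j ^ r)) ^ m *
      (Polynomial.X ^ k * ∏ l ∈ (Finset.univ.erase i).erase j,
        (Polynomial.X - Polynomial.C (X l ^ r)) ^ m)) := by
    rw [integrand, ← Finset.mul_prod_erase _ _ (Finset.mem_univ i),
      ← Finset.mul_prod_erase _ _ (Finset.mem_erase.2 ⟨hij.symm, Finset.mem_univ j⟩)]
    ring
  have hζ0 : ζ ≠ 0 := by
    rintro rfl
    rw [zero_pow (by omega)] at hζ
    exact zero_ne_one hζ
  have hy : (C ζ * X j : PolyS ℓ) ≠ 0 := mul_ne_zero (C_ne_zero.2 hζ0) (X_ne_zero j)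
  have hyr : (C ζ * X j : PolyS ℓ) ^ r = X j ^ r := by
    rw [mul_pow, ← map_pow, hζ, map_one, one_mul]
  have := sub_pow_dvd_diagonalMap (fun n => (C (primitiveCoeff A N r n) : PolyS ℓ))
    (primitiveCoeff_spec hr hA hN) (X i) hy m m (Polynomial.X ^ k *
      ∏ l ∈ (Finset.univ.erase i).erase j, (Polynomial.X - Polynomial.C (X l ^ r)) ^ m)
  rw [hyr, ← hsplit] at this
  simpa only [primitiveValue, mul_assoc, two_mul] using this

/-- The polynomial scaling the `k`-th element of the basis. -/
def basisScaling (d : Fin ℓ → ℕ) (k : Fin ℓ) : PolyS ℓ :=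
  if (k : ℕ) = 0 then ∏ j, X j ^ d j else 1

lemma basisScaling_ne_zero (d : Fin ℓ → ℕ) (k : Fin ℓ) : basisScaling d k ≠ 0 := by
  unfold basisScaling
  split_ifs
  · exact Finset.prod_ne_zero_iff.2 fun j _ => pow_ne_zero _ (X_ne_zero j)
  · exact one_ne_zero

lemma isHomogeneous_basisScaling (d : Fin ℓ → ℕ) (k : Fin ℓ) :
    (basisScaling d k).IsHomogeneous (if (k : ℕ) = 0 then ∑ j, d j else 0) := by
  unfold basisScaling
  split_ifs
  · exact IsHomogeneous.prod _ _ _ fun j _ => isHomogeneous_X_pow j (d j)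
  · exact isHomogeneous_one _ _

lemma exists_basis_coeff {A N r m : ℕ} {mi d : Fin ℓ → ℕ}
    (hN : N + 1 = (m + 1) * r) (hmi : ∀ i, mi i ≤ A) (hd : ∀ i, d i + A + 1 = mi i + r)
    (k i : Fin ℓ) :
    ∃ T : PolyS ℓ, X i ^ mi i ∣ T ∧
      X i ^ N * T = basisScaling d k * (X i ^ A * primitiveValue A N r m k i) := by
  obtain ⟨w, hw⟩ := X_pow_dvd_primitiveValue A N r m k i
  rw [hw, basisScaling]
  have hdi := hd i
  split_ifs with hk
  · refine ⟨X i ^ mi i * ((∏ j ∈ Finset.univ.erase i, X j ^ d j) * w), dvd_mul_right _ _, ?_⟩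
    have hexp : N + mi i = d i + A + r * m := by linarith
    have hpow := congrArg (fun n => (X i : PolyS ℓ) ^ n) hexp
    simp only [pow_add] at hpow
    rw [← Finset.mul_prod_erase _ _ (Finset.mem_univ i), hk, add_zero, ← pow_mul]
    linear_combination ((∏ j ∈ Finset.univ.erase i, X j ^ d j) * w) * hpow
  · obtain ⟨k', hk'⟩ := Nat.exists_eq_succ_of_ne_zero hk
    refine ⟨X i ^ mi i * (X i ^ (A - mi i + 1 + r * k') * w), dvd_mul_right _ _, ?_⟩
    have hexp : N + (mi i + (A - mi i + 1 + r * k')) = A + r * (m + k) := by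
      rw [hk']
      have := hmi i
      have h1 : mi i + (A - mi i + 1 + r * k') = A + 1 + r * k' := by omega
      rw [h1, Nat.succ_eq_add_one]
      linarith
    have hpow := congrArg (fun n => (X i : PolyS ℓ) ^ n) hexp
    rw [pow_add _ N, pow_add _ (mi i), pow_add _ A] at hpow
    rw [← pow_mul, one_mul]
    linear_combination w * hpow

lemma det_ne_zero_of_primitiveValue {A N r q m : ℕ} (hr : 2 ≤ r) (hA : A = q * r)
    (hN : N + 1 = (m + 1) * r) {d : Fin ℓ → ℕ} {T : Matrix (Fin ℓ) (Fin ℓ) (PolyS ℓ)}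
    (hT : ∀ k i, X i ^ N * T k i = basisScaling d k * (X i ^ A * primitiveValue A N r m k i)) :
    T.det ≠ 0 := by
  intro h0
  obtain ⟨v, hv0, hv⟩ := Matrix.exists_vecMul_eq_zero_iff.2 h0
  refine hv0 ?_
  set p : Polynomial (PolyS ℓ) :=
    ∑ k : Fin ℓ, Polynomial.C (v k * basisScaling d k) * Polynomial.X ^ (k : ℕ) with hp
  have hdeg : p.degree < Fintype.card (Fin ℓ) := by
    rw [Fintype.card_fin]
    exact Polynomial.degree_sum_fin_lt _
  have hp0 : p = 0 := by
    refine eq_zero_of_eval_diagonalMap_eq_zero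
      (fun n => (C (primitiveCoeff A N r n) : PolyS ℓ)) (e := (r : PolyS ℓ))
      (by exact_mod_cast (by omega : r ≠ 0)) (primitiveCoeff_spec hr hA hN)
      (v := fun i : Fin ℓ => (X i : PolyS ℓ) ^ r) ?_ (fun i => pow_ne_zero _ (X_ne_zero i)) m
      hdeg ?_
    · intro i j hij
      by_contra hne
      have := congrArg (MvPolynomial.eval (Pi.single i (1 : ℂ))) hij
      have hr0 : r ≠ 0 := by omega
      simp [Ne.symm hne, hr0] at this
    · intro i
      have hsum : p * ∏ j : Fin ℓ, (Polynomial.X - Polynomial.C (X j ^ r)) ^ m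
          = ∑ k : Fin ℓ, Polynomial.C (v k * basisScaling d k) * integrand ℓ r m k := by
        rw [hp, Finset.sum_mul]
        exact Finset.sum_congr rfl fun k _ => mul_assoc _ _ _
      have hvi := congrFun hv i
      rw [Matrix.vecMul, dotProduct] at hvi
      have hX : (X i : PolyS ℓ) ^ A ≠ 0 := pow_ne_zero _ (X_ne_zero i)
      refine mul_left_cancel₀ hX ?_
      rw [hsum, map_sum, Polynomial.eval_finsetSum, mul_zero, Finset.mul_sum,
        ← mul_zero (X i ^ N), ← Pi.zero_apply (M := fun _ => PolyS ℓ) i, ← hvi, Finset.mul_sum]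
      refine Finset.sum_congr rfl fun k _ => ?_
      rw [diagonalMap_mul, Polynomial.eval_mul, Polynomial.eval_C]
      change X i ^ A * (_ * primitiveValue A N r m k i) = _
      linear_combination (-v k) * hT k i
  funext k
  have hcoeff := congrArg (fun f => Polynomial.coeff f (k : ℕ)) hp0
  simp only [hp, Polynomial.finsetSum_coeff, Polynomial.coeff_C_mul_X_pow, Fin.val_inj,
    Finset.sum_ite_eq, Finset.mem_univ, if_true, Polynomial.coeff_zero] at hcoeff
  exact (mul_eq_zero.1 hcoeff).resolve_right (basisScaling_ne_zero d k)

lemma X_sub_C_mul_X_pow_dvd_sub {A N r q m : ℕ} (hr : 2 ≤ r) (hA : A = q * r)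
    (hN : N + 1 = (m + 1) * r) {d : Fin ℓ → ℕ} {k i j : Fin ℓ} {T U : PolyS ℓ}
    (hT : X i ^ N * T = basisScaling d k * (X i ^ A * primitiveValue A N r m k i))
    (hU : X j ^ N * U = basisScaling d k * (X j ^ A * primitiveValue A N r m k j))
    (hij : i ≠ j) {ζ : ℂ} (hζ : ζ ^ r = 1) :
    (X i - C ζ * X j) ^ (2 * m + 1) ∣ T - C ζ * U := by
  have hζ0 : ζ ≠ 0 := by
    rintro rfl
    rw [zero_pow (by omega)] at hζ
    exact zero_ne_one hζ
  have hα := prime_X_sub_C_mul_X hij ζ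
  have hnot : ¬ (X i - C ζ * X j : PolyS ℓ) ∣ X i ^ N * (C ζ * X j) ^ N := by
    refine not_dvd_of_eval_s6 (fun l => if l = i then ζ else 1) ?_ ?_
    · simp [hij.symm]
    · simp [hij.symm, hζ0]
  refine hα.pow_dvd_of_dvd_mul_left _ hnot ?_
  have hζA : (C ζ : PolyS ℓ) ^ A = 1 := by
    rw [hA, mul_comm, pow_mul, ← map_pow, hζ, map_one, one_pow]
  have hζN : (C ζ : PolyS ℓ) ^ N * C ζ = 1 := by
    rw [← pow_succ, hN, mul_comm, pow_mul, ← map_pow, hζ, map_one, one_pow]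
  refine ((X_sub_C_mul_X_pow_dvd_primitiveValue hr hA hN k hij hζ).mul_left
    (basisScaling d k)).trans (dvd_of_eq ?_)
  simp only [mul_pow, hζA, one_mul]
  linear_combination (-(C ζ ^ N * X j ^ N)) * hT + X i ^ N * hU + (X i ^ N * X j ^ N * U) * hζN

end Basis

/-- The multiplicities on the coordinate hyperplanes lie in a common window of length `r`. -/
lemma exists_common_window {r ℓ : ℕ} (hr : 2 ≤ r) (hℓ : 2 ≤ ℓ) {mi : Fin ℓ → ℕ} {q : ℤ}
    (hq : ∀ i, Int.fdiv ((mi i : ℤ) - 1) (r : ℤ) = q) :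
    ∃ Q : ℕ, (Q : ℤ) = q + 1 ∧ ∀ i, mi i ≤ Q * r ∧ Q * r + 1 ≤ mi i + r := by
  have hr0 : (0 : ℤ) < r := by omega
  have hdiv (i : Fin ℓ) : ((mi i : ℤ) - 1) / r = q := by
    rw [← hq i, Int.fdiv_eq_ediv_of_nonneg _ hr0.le]
  have hq1 : -1 ≤ q := by
    rw [← hdiv ⟨0, by omega⟩, Int.le_ediv_iff_mul_le hr0]
    omega
  refine ⟨(q + 1).toNat, by omega, fun i => ?_⟩
  have hle := Int.ediv_mul_le ((mi i : ℤ) - 1) hr0.ne'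
  have hlt := Int.lt_ediv_add_one_mul_self ((mi i : ℤ) - 1) hr0
  rw [hdiv i] at hle hlt
  have hcast : (((q + 1).toNat * r : ℕ) : ℤ) = q * r + r := by
    rw [Nat.cast_mul, Int.toNat_of_nonneg (by omega)]
    ring
  rw [add_mul, one_mul] at hlt
  omega

theorem stmt6 (r ℓ : ℕ) (hr : 2 ≤ r) (hℓ : 2 ≤ ℓ)
    (m : ℕ) (mi : Fin ℓ → ℕ)
    (q : ℤ) (hq : ∀ i, Int.fdiv ((mi i : ℤ) - 1) (r : ℤ) = q) :
    IsFreeWithExponentsZ (InDeriv r mi (2 * m + 1))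
      (fun i =>
        if (i : ℕ) = 0 then
          ((m : ℤ) * ((ℓ - 1) * r) + q * r + 1) + (∑ j, (mi j : ℤ)) - ℓ * (q * r + 1)
        else ((m : ℤ) * ((ℓ - 1) * r) + q * r + 1) + (i : ℕ) * r) := by
  obtain ⟨Q, hQ, hwin⟩ := exists_common_window hr hℓ hq
  obtain ⟨A, hA⟩ : ∃ A, A = Q * r := ⟨_, rfl⟩
  obtain ⟨N, hN⟩ : ∃ N, N + 1 = (m + 1) * r :=
    ⟨(m + 1) * r - 1, Nat.sub_add_cancel (Nat.mul_pos m.succ_pos (by omega))⟩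
  rw [← hA] at hwin
  obtain ⟨d, hd⟩ : ∃ d : Fin ℓ → ℕ, ∀ i, d i + A + 1 = mi i + r :=
    ⟨fun i => mi i + r - (A + 1), fun i => by have := (hwin i).2; dsimp only; omega⟩
  choose T hTdvd hT using exists_basis_coeff hN (fun i => (hwin i).1) hd
  obtain ⟨e, he⟩ : ∃ e : Fin ℓ → ℕ, ∀ k, N + e k
      = (if (k : ℕ) = 0 then ∑ j, d j else 0) + (A + (m * ℓ + k) * r) := by
    have hNle (k : Fin ℓ) : N ≤ (if (k : ℕ) = 0 then ∑ j, d j else 0) + (A + (m * ℓ + k) * r) := by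
      have hmℓ : m * r ≤ m * ℓ * r :=
        Nat.mul_le_mul_right r (Nat.le_mul_of_pos_right m (by omega))
      rw [add_mul] at hN ⊢
      split_ifs with hk
      · have := Finset.single_le_sum (fun j _ => Nat.zero_le (d j)) (Finset.mem_univ k)
        have := hd k
        omega
      · have : r ≤ k * r := Nat.le_mul_of_pos_left r (Nat.pos_of_ne_zero hk)
        omega
    choose e he using fun k => Nat.exists_eq_add_of_le (hNle k)
    exact ⟨e, fun k => (he k).symm⟩
  let θ : Fin ℓ → Derivation ℂ (PolyS ℓ) (PolyS ℓ) := fun k => mkDerivation ℂ (T k)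
  have hθX (k i : Fin ℓ) : θ k (X i) = T k i := mkDerivation_X _ _ _
  have hθ (k : Fin ℓ) : InDeriv r mi (2 * m + 1) (θ k) := by
    refine ⟨fun i => ?_, fun i j hij ζ hζ => ?_⟩
    · rw [hθX, Ideal.mem_span_singleton]
      exact hTdvd k i
    · rw [Ideal.mem_span_singleton, map_sub, ← smul_eq_C_mul (X j) ζ, Derivation.map_smul, hθX,
        hθX, smul_eq_C_mul, smul_eq_C_mul]
      exact X_sub_C_mul_X_pow_dvd_sub hr hA hN (hT k i) (hT k j) hij.ne hζ
  have hhom (k : Fin ℓ) : IsHomogDeriv (θ k) (e k) := by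
    intro i
    rw [hθX]
    refine IsHomogeneous.of_X_pow_mul (i := i) (N := N) ?_
    rw [hT, he]
    exact (isHomogeneous_basisScaling d k).mul
      ((isHomogeneous_X_pow i A).mul (isHomogeneous_primitiveValue A N r m k i))
  have hmat : derivMatrix θ = Matrix.of T := by
    ext1 k i
    exact hθX k i
  have hdet : (derivMatrix θ).det ≠ 0 := by
    rw [hmat]
    exact det_ne_zero_of_primitiveValue hr hA hN hT
  have hdsum : (∑ j, (d j : ℤ)) = (∑ j, (mi j : ℤ)) - ℓ * (q * r + 1) := by
    have hterm (j : Fin ℓ) : (d j : ℤ) = mi j - (q * r + 1) := by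
      have h1 : (d j : ℤ) + A + 1 = mi j + r := by exact_mod_cast hd j
      have h2 : (A : ℤ) = (q + 1) * r := by rw [hA, ← hQ, Nat.cast_mul]
      linear_combination h1 - h2
    simp [hterm]
  have hexp (k : Fin ℓ) : (e k : ℤ) = (if (k : ℕ) = 0 then (∑ j, (d j : ℤ)) else 0)
      + (m * ((ℓ - 1) * r) + q * r + 1 + (k : ℕ) * r) := by
    have h1 : (N : ℤ) + e k = (if (k : ℕ) = 0 then (∑ j, (d j : ℤ)) else 0)
        + (A + (m * ℓ + (k : ℕ)) * r) := by
      exact_mod_cast he k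
    have h2 : (A : ℤ) = (q + 1) * r := by rw [hA, ← hQ, Nat.cast_mul]
    have h3 : (N : ℤ) + 1 = (m + 1) * r := by exact_mod_cast hN
    linear_combination h1 + h2 - h3
  have hsum : ∑ k, e k = ∑ i, mi i + (∑ i : Fin ℓ, (i : ℕ)) * r * (2 * m + 1) := by
    have hgauss : (∑ i : Fin ℓ, ((i : ℕ) : ℤ)) * 2 = ℓ * (ℓ - 1) := by
      have h := Finset.sum_range_id_mul_two ℓ
      rw [← Fin.sum_univ_eq_sum_range (fun i => i)] at h
      have h' := congrArg (Nat.cast : ℕ → ℤ) h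
      rw [Nat.cast_mul, Nat.cast_mul, Nat.cast_sub (by omega)] at h'
      exact_mod_cast h'
    have hfirst : ∑ k : Fin ℓ, (if (k : ℕ) = 0 then (∑ j, (d j : ℤ)) else 0)
        = ∑ j, (d j : ℤ) := by
      rw [Finset.sum_eq_single ⟨0, by omega⟩]
      · simp
      · intro k _ hk
        exact if_neg fun h => hk (Fin.ext h)
      · simp
    have hz : (∑ k, (e k : ℤ)) = ∑ i, (mi i : ℤ)
        + (∑ i : Fin ℓ, ((i : ℕ) : ℤ)) * r * (2 * m + 1) := by
      simp only [hexp, Finset.sum_add_distrib, hfirst, ← Finset.sum_mul, Finset.sum_const,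
        Finset.card_univ, Fintype.card_fin, nsmul_eq_mul]
      rw [hdsum]
      linear_combination (-(m * r : ℤ)) * hgauss
    exact_mod_cast hz
  obtain ⟨hind, hspan⟩ := linearIndependent_and_span_of_det_ne_zero (by omega) hθ hhom hsum hdet
  refine ⟨θ, hθ, hind, hspan, fun k => ⟨e k, ?_, hhom k⟩⟩
  rw [hexp]
  dsimp only
  split_ifs with hk
  · rw [hdsum, hk]
    push_cast
    ring
  · ring
end
end
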